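/- arXiv:0911.3971 — 2 statements merged into one kernel-verified Lean document; each statement's English description precedes it below -/
import Mathlib

section
/- Let 0 ≤ d < 1 and let Ω ⊆ (0, π/2) have upper Minkowski dimension at most d, and set τ = 2/(1−d)² − 2; assume τ < 1. Then for every ε > 0 there exists a constant C > 0 such that for every N ≥ 2 and for every probability measure μ on the parameter space T = {(φ, p, w, h) ∈ [0, π/2] × [0,1]² × (0,1]² : φ ∈ Ω ∪ {0} and R(φ,p,w,h) ⊆ [0,1]²}, where R(φ,p,w,h) denotes the rectangle obtained by rotating [0,w] × [0,h] by angle φ and translating by p, there is a set P of N points in [0,1]² with (∫_T |#(P ∩ R(t)) − N·area(R(t))|² dμ(t))^{1/2} ≤ C·N^{τ/(2(τ+1)) + ε}. -/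
open MeasureTheory

noncomputable section

/-- Rotation of the plane by angle `φ`. -/
def rot (φ : ℝ) (x : ℝ × ℝ) : ℝ × ℝ :=
  (x.1 * Real.cos φ - x.2 * Real.sin φ, x.1 * Real.sin φ + x.2 * Real.cos φ)

/-- The rectangle obtained by rotating `[0,w] × [0,h]` by angle `φ` and translating by `p`. -/
def rect (φ : ℝ) (p : ℝ × ℝ) (w h : ℝ) : Set (ℝ × ℝ) :=
  (fun x => p + rot φ x) '' (Set.Icc 0 w ×ˢ Set.Icc 0 h)

/-- The unit square `[0,1]²`. -/
def unitSq : Set (ℝ × ℝ) := Set.Icc (0:ℝ) 1 ×ˢ Set.Icc (0:ℝ) 1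

/-- `Ω` has upper Minkowski dimension at most `d`. -/
def MinkowskiBound (Ω : Set ℝ) (d : ℝ) : Prop :=
  ∀ s : ℝ, d < s → ∃ Cs : ℝ, ∀ δ : ℝ, 0 < δ → δ < 1 →
    ∃ F : Finset ℝ, (F.card : ℝ) ≤ Cs * δ ^ (-s) ∧
      Ω ⊆ ⋃ x ∈ F, Set.Icc x (x + δ)

/-- The parameter space `T` of rectangles: tuples `(φ, p, w, h)` with
`φ ∈ (Ω ∪ {0}) ∩ [0, π/2]`, `p ∈ [0,1]²`, `w, h ∈ (0,1]`, and the corresponding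
rectangle contained in `[0,1]²`. -/
def paramSet (Ω : Set ℝ) : Set (ℝ × (ℝ × ℝ) × ℝ × ℝ) :=
  {t | t.1 ∈ Set.Icc 0 (Real.pi / 2) ∧ (t.1 ∈ Ω ∨ t.1 = 0) ∧
       t.2.1 ∈ unitSq ∧ t.2.2.1 ∈ Set.Ioc (0:ℝ) 1 ∧ t.2.2.2 ∈ Set.Ioc (0:ℝ) 1 ∧
       rect t.1 t.2.1 t.2.2.1 t.2.2.2 ⊆ unitSq}

/-- The centred sawtooth `⌊x⌋ - x + 1/2`. -/
def saw (x : ℝ) : ℝ := 1 / 2 - Int.fract x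

lemma sum_emod_affine {q : ℕ} (hq : 0 < q) (p m : ℤ) (hpq : IsCoprime p (q : ℤ)) :
    ∑ n ∈ Finset.range q, (((n : ℤ) * p + m) % q : ℤ) = ∑ n ∈ Finset.range q, (n : ℤ) := by
  have hq' : (q : ℤ) ≠ 0 := by positivity
  have hq0 : (0 : ℤ) < q := by positivity
  have hmaps : ∀ n ∈ Finset.range q, (((n : ℤ) * p + m) % q).toNat ∈ Finset.range q := by
    intro n _
    have h1 := Int.emod_nonneg ((n : ℤ) * p + m) hq'
    have h2 := Int.emod_lt_of_pos ((n : ℤ) * p + m) hq0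
    rw [Finset.mem_range]; omega
  have hinj : Set.InjOn (fun n : ℕ => (((n : ℤ) * p + m) % q).toNat) (Finset.range q) := by
    intro a ha b hb hab
    have ha' := Finset.mem_range.1 (Finset.mem_coe.1 ha)
    have hb' := Finset.mem_range.1 (Finset.mem_coe.1 hb)
    have h1 := Int.emod_nonneg ((a : ℤ) * p + m) hq'
    have h2 := Int.emod_nonneg ((b : ℤ) * p + m) hq'
    have h3 : ((a : ℤ) * p + m) % q = ((b : ℤ) * p + m) % q := by
      simp only at hab; omega
    have h4 : (q : ℤ) ∣ ((b : ℤ) - a) * p := by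
      have := Int.ModEq.dvd h3
      convert this using 1; ring
    have h5 : (q : ℤ) ∣ (b : ℤ) - a := hpq.symm.dvd_of_dvd_mul_right h4
    have h6 := Int.eq_zero_of_abs_lt_dvd h5 (by rw [abs_lt]; constructor <;> omega)
    omega
  have himg : (Finset.range q).image (fun n : ℕ => (((n : ℤ) * p + m) % q).toNat)
      = Finset.range q := by
    apply Finset.eq_of_subset_of_card_le
    · intro x hx
      obtain ⟨n, hn, rfl⟩ := Finset.mem_image.1 hx
      exact hmaps n hn
    · rw [Finset.card_image_of_injOn hinj]
  conv_rhs => rw [← himg]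
  rw [Finset.sum_image hinj]
  refine Finset.sum_congr rfl fun n _ => ?_
  have h1 := Int.emod_nonneg ((n : ℤ) * p + m) hq'
  omega

lemma fract_intCast_add_div {q : ℕ} (hq : 0 < q) (a : ℤ) {t : ℝ} (ht0 : 0 ≤ t) (ht1 : t < 1) :
    Int.fract (((a : ℝ) + t) / q) = (((a % q : ℤ) : ℝ) + t) / q := by
  have hq0 : (0 : ℝ) < q := by exact_mod_cast hq
  have h1 := Int.emod_nonneg a (by positivity : (q : ℤ) ≠ 0)
  have h2 : a % q + 1 ≤ q := Int.emod_lt_of_pos a (by positivity : (0 : ℤ) < q)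
  have h1' : (0 : ℝ) ≤ ((a % q : ℤ) : ℝ) := by exact_mod_cast h1
  have h2' : ((a % q : ℤ) : ℝ) + 1 ≤ q := by exact_mod_cast h2
  rw [Int.fract_eq_iff]
  refine ⟨by positivity, by rw [div_lt_one hq0]; linarith, a / q, ?_⟩
  have h3 : ((a % q : ℤ) : ℝ) + q * ((a / q : ℤ) : ℝ) = a := by
    exact_mod_cast Int.emod_add_mul_ediv a q
  field_simp
  linarith

lemma sum_saw_rat {q : ℕ} (hq : 0 < q) (p : ℤ) (hpq : IsCoprime p (q : ℤ)) (x : ℝ) :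
    ∑ n ∈ Finset.range q, saw ((n : ℝ) * (p / q) + x) = saw (q * x) := by
  have hq0 : (0 : ℝ) < q := by exact_mod_cast hq
  have hterm : ∀ n : ℕ, saw ((n : ℝ) * (p / q) + x)
      = 1 / 2 - Int.fract (q * x) / q - ((((n : ℤ) * p + ⌊q * x⌋) % q : ℤ) : ℝ) / q := by
    intro n
    have h := fract_intCast_add_div hq ((n : ℤ) * p + ⌊q * x⌋)
      (Int.fract_nonneg (q * x)) (Int.fract_lt_one (q * x))
    have h2 : (((((n : ℤ) * p + ⌊q * x⌋ : ℤ)) : ℝ) + Int.fract (q * x)) / q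
        = (n : ℝ) * (p / q) + x := by
      push_cast
      rw [Int.fract]
      field_simp
      ring
    rw [saw, ← h2, h]
    ring
  have hs := sum_emod_affine hq p ⌊q * x⌋ hpq
  have hs' : ∑ n ∈ Finset.range q, ((((n : ℤ) * p + ⌊q * x⌋) % q : ℤ) : ℝ)
      = ∑ n ∈ Finset.range q, (n : ℝ) := by
    have h := congrArg (Int.cast : ℤ → ℝ) hs
    rw [Int.cast_sum, Int.cast_sum] at h
    simpa only [Int.cast_natCast] using h
  have hg : (∑ n ∈ Finset.range q, (n : ℝ)) * 2 = q * (q - 1) := by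
    clear * -
    induction q with
    | zero => simp
    | succ k ih => rw [Finset.sum_range_succ, add_mul, ih]; push_cast; ring
  simp_rw [hterm]
  rw [Finset.sum_sub_distrib, ← Finset.sum_div, hs', Finset.sum_const, Finset.card_range,
    nsmul_eq_mul, saw]
  field_simp
  linarith

lemma saw_le_add_of_abs_le {x y e : ℝ} (h : |x - y| ≤ e) : saw x ≤ saw (y + e) + 2 * e := by
  obtain ⟨h1, h2⟩ := abs_le.1 h
  have h3 : (⌊x⌋ : ℝ) ≤ ⌊y + e⌋ := by exact_mod_cast Int.floor_le_floor (by linarith)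
  simp only [saw, Int.fract]
  linarith

lemma le_saw_of_abs_le {x y e : ℝ} (h : |x - y| ≤ e) : saw (y - e) - 2 * e ≤ saw x := by
  obtain ⟨h1, h2⟩ := abs_le.1 h
  have h3 : (⌊y - e⌋ : ℝ) ≤ ⌊x⌋ := by exact_mod_cast Int.floor_le_floor (by linarith)
  simp only [saw, Int.fract]
  linarith

lemma abs_saw_le (x : ℝ) : |saw x| ≤ 1 / 2 := by
  have h1 := Int.fract_nonneg x
  have h2 := Int.fract_lt_one x
  rw [saw, abs_le]
  constructor <;> linarith

lemma abs_sum_saw_block {q : ℕ} (hq : 0 < q) (p : ℤ) (hpq : IsCoprime p (q : ℤ)) {β : ℝ}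
    (hβ : |β - p / q| ≤ 1 / (q : ℝ) ^ 2) (γ : ℝ) :
    |∑ n ∈ Finset.range q, saw ((n : ℝ) * β + γ)| ≤ 5 / 2 := by
  have hq0 : (0 : ℝ) < q := by exact_mod_cast hq
  have hclose : ∀ n ∈ Finset.range q,
      |((n : ℝ) * β + γ) - ((n : ℝ) * (p / q) + γ)| ≤ 1 / q := by
    intro n hn
    have hn' : (n : ℝ) ≤ q := by exact_mod_cast (Finset.mem_range.1 hn).le
    have : ((n : ℝ) * β + γ) - ((n : ℝ) * (p / q) + γ) = n * (β - p / q) := by ring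
    rw [this, abs_mul, Nat.abs_cast]
    calc (n : ℝ) * |β - p / q| ≤ q * (1 / (q : ℝ) ^ 2) := by gcongr
      _ = 1 / q := by field_simp
  have hconst : ∑ _n ∈ Finset.range q, 2 * (1 / (q : ℝ)) = 2 := by
    rw [Finset.sum_const, Finset.card_range, nsmul_eq_mul]; field_simp
  rw [abs_le]
  constructor
  · have h := Finset.sum_le_sum fun n hn => le_saw_of_abs_le (hclose n hn)
    rw [Finset.sum_sub_distrib, hconst] at h
    simp_rw [add_sub_assoc] at h
    rw [sum_saw_rat hq p hpq] at h
    have := (abs_le.1 (abs_saw_le (q * (γ - 1 / q)))).1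
    linarith
  · have h := Finset.sum_le_sum fun n hn => saw_le_add_of_abs_le (hclose n hn)
    rw [Finset.sum_add_distrib, hconst] at h
    simp_rw [add_assoc] at h
    rw [sum_saw_rat hq p hpq] at h
    have := (abs_le.1 (abs_saw_le (q * (γ + 1 / q)))).2
    linarith

lemma abs_sum_saw_blocks {q : ℕ} (hq : 0 < q) (p : ℤ) (hpq : IsCoprime p (q : ℤ)) {β : ℝ}
    (hβ : |β - p / q| ≤ 1 / (q : ℝ) ^ 2) (B : ℕ) (γ : ℝ) :
    |∑ n ∈ Finset.range (q * B), saw ((n : ℝ) * β + γ)| ≤ 5 / 2 * B := by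
  induction B with
  | zero => simp
  | succ B ih =>
    rw [mul_add, mul_one, Finset.sum_range_add]
    have h := abs_sum_saw_block hq p hpq hβ (((q * B : ℕ) : ℝ) * β + γ)
    have e : ∀ n : ℕ, (((q * B + n : ℕ) : ℝ) * β + γ)
        = (n : ℝ) * β + (((q * B : ℕ) : ℝ) * β + γ) := by intro n; push_cast; ring
    simp_rw [e]
    refine (abs_add_le _ _).trans ?_
    push_cast at ih h ⊢
    linarith

/-- `β` is badly approximable with constant `c` and exponent `1 + σ`. -/
def DiophBad (c σ β : ℝ) : Prop :=
  ∀ q : ℕ, 0 < q → ∀ p : ℤ, c * (q : ℝ) ^ (-(1 + σ)) ≤ |q * β - p|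

lemma abs_sum_saw_le {c σ : ℝ} (hc : 0 < c) (hσ : 0 < σ) :
    ∃ K : ℝ, 0 < K ∧ ∀ β : ℝ, DiophBad c σ β → ∀ (M : ℕ) (γ : ℝ),
      |∑ n ∈ Finset.range M, saw ((n : ℝ) * β + γ)| ≤ K * (M : ℝ) ^ (σ / (1 + σ)) := by
  set a := σ / (1 + σ) with ha
  have ha0 : 0 < a := by positivity
  set A := 5 / 2 * c ^ (-(1 / (1 + σ))) with hA
  have hA0 : 0 < A := by positivity
  have h2 : (1 / 2 : ℝ) ^ a < 1 := Real.rpow_lt_one (by norm_num) (by norm_num) ha0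
  refine ⟨A / (1 - (1 / 2 : ℝ) ^ a), div_pos hA0 (by linarith), fun β hβ M => ?_⟩
  set K := A / (1 - (1 / 2 : ℝ) ^ a) with hK
  have hK0 : 0 < K := div_pos hA0 (by linarith)
  have hKA : A + K * (1 / 2 : ℝ) ^ a = K := by
    rw [hK]; have : (1 - (1 / 2 : ℝ) ^ a) ≠ 0 := by linarith
    field_simp; ring
  induction M using Nat.strong_induction_on with
  | _ M ih =>
    intro γ
    rcases Nat.eq_zero_or_pos M with rfl | hM
    · simp; positivity
    obtain ⟨r, hr1, hr2⟩ := Real.exists_rat_abs_sub_le_and_den_le β hM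
    set q := r.den with hqdef
    have hq : 0 < q := r.den_pos
    have hq0 : (0 : ℝ) < q := by exact_mod_cast hq
    have hM0 : (0 : ℝ) < M := by exact_mod_cast hM
    have hqM : (q : ℝ) ≤ M := by exact_mod_cast hr2
    have hcop : IsCoprime r.num (q : ℤ) := by
      rw [Int.isCoprime_iff_gcd_eq_one]
      simpa [Int.gcd] using r.reduced
    have hrc : (r : ℝ) = (r.num : ℝ) / q := Rat.cast_def r
    rw [hrc] at hr1
    have hβq : |β - r.num / q| ≤ 1 / (q : ℝ) ^ 2 := by
      refine hr1.trans ?_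
      apply one_div_le_one_div_of_le (by positivity)
      nlinarith
    have hdio := hβ q hq r.num
    have hlow : |q * β - r.num| ≤ 1 / M := by
      have e : q * β - r.num = q * (β - r.num / q) := by field_simp
      rw [e, abs_mul, Nat.abs_cast]
      calc (q : ℝ) * |β - r.num / q| ≤ q * (1 / ((M + 1) * q)) := by gcongr
        _ = 1 / (M + 1) := by field_simp
        _ ≤ 1 / M := by apply one_div_le_one_div_of_le hM0; linarith
    have hMq : c * M ≤ (q : ℝ) ^ (1 + σ) := by
      have h := hdio.trans hlow
      rw [Real.rpow_neg hq0.le, ← div_eq_mul_inv, div_le_div_iff₀ (by positivity) hM0] at h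
      linarith
    have hq1 : (c * M) ^ (1 / (1 + σ)) ≤ q := by
      calc (c * M) ^ (1 / (1 + σ)) ≤ ((q : ℝ) ^ (1 + σ)) ^ (1 / (1 + σ)) := by gcongr
        _ = q := by
          rw [← Real.rpow_mul hq0.le, mul_one_div_cancel (by positivity), Real.rpow_one]
    have hdiv : (M : ℝ) / q ≤ c ^ (-(1 / (1 + σ))) * (M : ℝ) ^ a := by
      rw [div_le_iff₀ hq0]
      calc (M : ℝ) = c ^ (-(1 / (1 + σ))) * (M : ℝ) ^ a * (c * M) ^ (1 / (1 + σ)) := by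
            rw [Real.mul_rpow hc.le hM0.le]
            have e1 : c ^ (-(1 / (1 + σ))) * c ^ (1 / (1 + σ)) = 1 := by
              rw [← Real.rpow_add hc]; simp
            have e2 : (M : ℝ) ^ a * (M : ℝ) ^ (1 / (1 + σ)) = M := by
              rw [← Real.rpow_add hM0, ha, ← add_div, add_comm σ 1, div_self (by positivity),
                Real.rpow_one]
            linear_combination (-M : ℝ) * e1 - (c ^ (-(1 / (1 + σ))) * c ^ (1 / (1 + σ))) * e2
        _ ≤ _ := by gcongr
    have hB : ((M / q : ℕ) : ℝ) ≤ M / q := Nat.cast_div_le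
    have hmod : M % q < q := Nat.mod_lt _ hq
    have hdm : q * (M / q) + M % q = M := Nat.div_add_mod M q
    have hhalf : 2 * (M % q) ≤ M := by
      have h1 : 1 ≤ M / q := (Nat.one_le_div_iff hq).2 hr2
      nlinarith
    have hrM : M % q < M := by omega
    have hrhalf : ((M % q : ℕ) : ℝ) ≤ 1 / 2 * M := by
      have : (2 : ℝ) * ((M % q : ℕ) : ℝ) ≤ M := by exact_mod_cast hhalf
      linarith
    have e : ∀ n : ℕ, (((q * (M / q) + n : ℕ) : ℝ) * β + γ)
        = (n : ℝ) * β + (((q * (M / q) : ℕ) : ℝ) * β + γ) := by intro n; push_cast; ring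
    have hsplit : ∑ n ∈ Finset.range M, saw ((n : ℝ) * β + γ)
        = ∑ n ∈ Finset.range (q * (M / q)), saw ((n : ℝ) * β + γ)
          + ∑ n ∈ Finset.range (M % q),
              saw ((n : ℝ) * β + (((q * (M / q) : ℕ) : ℝ) * β + γ)) := by
      conv_lhs => rw [← hdm, Finset.sum_range_add]
      simp_rw [e]
    have hi := ih _ hrM (((q * (M / q) : ℕ) : ℝ) * β + γ)
    have hb := abs_sum_saw_blocks hq r.num hcop hβq (M / q) γ
    rw [hsplit]
    calc _ ≤ 5 / 2 * ((M / q : ℕ) : ℝ) + K * ((M % q : ℕ) : ℝ) ^ a :=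
          (abs_add_le _ _).trans (add_le_add hb hi)
      _ ≤ 5 / 2 * (c ^ (-(1 / (1 + σ))) * (M : ℝ) ^ a) + K * (1 / 2 * M) ^ a := by
          have := hB.trans hdiv
          gcongr
      _ = (A + K * (1 / 2 : ℝ) ^ a) * (M : ℝ) ^ a := by
          rw [Real.mul_rpow (by norm_num) hM0.le, hA]; ring
      _ = K * (M : ℝ) ^ a := by rw [hKA]

lemma abs_sum_ramp (K : ℕ) {y : ℝ} (h1 : -1 < y) (h2 : y ≤ K) :
    |∑ n ∈ Finset.range K, max ((n : ℝ) - y) 0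
      - (((K : ℝ) - 1 - y) ^ 2 + ((K : ℝ) - 1 - y)) / 2| ≤ 1 / 8 := by
  have key : ∀ t : ℝ, -1 ≤ t → t ≤ 0 → |0 - (t ^ 2 + t) / 2| ≤ 1 / 8 := by
    intro t _ _
    rw [abs_le]
    constructor <;> nlinarith [sq_nonneg (t + 1 / 2)]
  induction K with
  | zero =>
    simp only [Nat.cast_zero] at h2
    simpa using key (-1 - y) (by linarith) (by linarith)
  | succ K ih =>
    push_cast at h2 ⊢
    rcases le_or_gt y K with h | h
    · rw [Finset.sum_range_succ, max_eq_left (by linarith)]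
      convert ih h using 2
      ring
    · have hz : ∑ n ∈ Finset.range (K + 1), max ((n : ℝ) - y) 0 = 0 := by
        refine Finset.sum_eq_zero fun n hn => max_eq_right ?_
        have : (n : ℝ) ≤ K := by exact_mod_cast Nat.lt_succ_iff.1 (Finset.mem_range.1 hn)
        linarith
      rw [hz]
      exact key _ (by linarith) (by linarith)

lemma abs_sum_saw_ite {β₁ β₂ B : ℝ} {K : ℕ}
    (h₁ : ∀ M ≤ K, ∀ γ : ℝ, |∑ n ∈ Finset.range M, saw ((n : ℝ) * β₁ + γ)| ≤ B)
    (h₂ : ∀ M ≤ K, ∀ γ : ℝ, |∑ n ∈ Finset.range M, saw ((n : ℝ) * β₂ + γ)| ≤ B)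
    (γ₁ γ₂ y : ℝ) :
    |∑ n ∈ Finset.range K,
      saw (if (n : ℝ) < y then (n : ℝ) * β₁ + γ₁ else (n : ℝ) * β₂ + γ₂)| ≤ 2 * B := by
  have hB : 0 ≤ B := (abs_nonneg _).trans (h₁ 0 (Nat.zero_le _) 0)
  rcases le_total K ⌈y⌉₊ with h | h
  · have e : ∑ n ∈ Finset.range K,
        saw (if (n : ℝ) < y then (n : ℝ) * β₁ + γ₁ else (n : ℝ) * β₂ + γ₂)
        = ∑ n ∈ Finset.range K, saw ((n : ℝ) * β₁ + γ₁) := by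
      refine Finset.sum_congr rfl fun n hn => ?_
      rw [if_pos (Nat.lt_ceil.1 ((Finset.mem_range.1 hn).trans_le h))]
    rw [e]
    linarith [h₁ K le_rfl γ₁]
  · obtain ⟨L, rfl⟩ := Nat.exists_eq_add_of_le h
    rw [Finset.sum_range_add]
    have e₁ : ∑ n ∈ Finset.range ⌈y⌉₊,
        saw (if (n : ℝ) < y then (n : ℝ) * β₁ + γ₁ else (n : ℝ) * β₂ + γ₂)
        = ∑ n ∈ Finset.range ⌈y⌉₊, saw ((n : ℝ) * β₁ + γ₁) := by
      refine Finset.sum_congr rfl fun n hn => ?_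
      rw [if_pos (Nat.lt_ceil.1 (Finset.mem_range.1 hn))]
    have e₂ : ∑ n ∈ Finset.range L,
        saw (if ((⌈y⌉₊ + n : ℕ) : ℝ) < y then ((⌈y⌉₊ + n : ℕ) : ℝ) * β₁ + γ₁
          else ((⌈y⌉₊ + n : ℕ) : ℝ) * β₂ + γ₂)
        = ∑ n ∈ Finset.range L, saw ((n : ℝ) * β₂ + ((⌈y⌉₊ : ℝ) * β₂ + γ₂)) := by
      refine Finset.sum_congr rfl fun n _ => ?_
      rw [if_neg (fun hlt => absurd (Nat.lt_ceil.2 hlt) (by omega))]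
      push_cast
      congr 1
      ring
    rw [e₁, e₂]
    refine (abs_add_le _ _).trans ?_
    linarith [h₁ ⌈y⌉₊ h γ₁, h₂ L (by omega) ((⌈y⌉₊ : ℝ) * β₂ + γ₂)]

/-- Lattice point count in a rectangle whose sides have directions `(c, s)` and `(-s, c)`. -/
lemma exists_lattice_count {c s W H B : ℝ} (hc : 0 < c) (hs : 0 < s) (hcs : c ^ 2 + s ^ 2 = 1)
    (hW : 0 ≤ W) (hH : 0 ≤ H)
    (hB : ∀ β : ℝ, β = c / s ∨ β = -(s / c) ∨ β = s / c ∨ β = -(c / s) →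
      ∀ M : ℕ, (M : ℝ) ≤ W + H + 1 → ∀ γ : ℝ,
        |∑ n ∈ Finset.range M, saw ((n : ℝ) * β + γ)| ≤ B) (u v : ℝ) :
    ∃ S : Finset (ℤ × ℤ),
      (∀ z : ℤ × ℤ, z ∈ S ↔ (u ≤ z.1 * c + z.2 * s ∧ z.1 * c + z.2 * s ≤ u + W) ∧
        (v ≤ z.2 * c - z.1 * s ∧ z.2 * c - z.1 * s ≤ v + H)) ∧
      |(S.card : ℝ) - W * H| ≤ 1 / (s * c) + 4 * B := by
  have hc1 : c ≤ 1 := by nlinarith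
  have hs1 : s ≤ 1 := by nlinarith
  set y₀ := s * u + c * v with hy₀
  set y₁ := y₀ + s * W with hy₁
  set y₂ := y₀ + c * H with hy₂
  set y₃ := y₀ + s * W + c * H with hy₃
  have hsW : 0 ≤ s * W := by positivity
  have hcH : 0 ≤ c * H := by positivity
  set lo : ℤ → ℝ := fun j => max ((u - j * s) / c) ((j * c - v - H) / s) with hlo
  set hi : ℤ → ℝ := fun j => min ((j * c - v) / s) ((u + W - j * s) / c) with hhi
  set A : ℤ := ⌈y₀⌉ with hA
  set E : ℤ := ⌊y₃⌋ with hE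
  have hAE : A ≤ E + 1 := by
    have h1 : ⌊y₀⌋ ≤ ⌊y₃⌋ := Int.floor_le_floor (by linarith)
    have h2 := Int.ceil_le_floor_add_one y₀
    omega
  obtain ⟨K, hK⟩ : ∃ K : ℕ, E + 1 - A = K := ⟨(E + 1 - A).toNat, by omega⟩
  have hKr : (K : ℝ) = E + 1 - A := by exact_mod_cast hK.symm
  have hA1 : y₀ ≤ A := Int.le_ceil _
  have hA2 : (A : ℝ) < y₀ + 1 := Int.ceil_lt_add_one _
  have hE1 : (E : ℝ) ≤ y₃ := Int.floor_le _
  have hE2 : y₃ < E + 1 := Int.lt_floor_add_one _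
  have hKle : (K : ℝ) ≤ W + H + 1 := by
    have : s * W ≤ 1 * W := by gcongr
    have : c * H ≤ 1 * H := by gcongr
    linarith
  -- the two boundary curves meet in the order given by the vertices
  have hgap : ∀ j : ℝ, (j * c - v) / s - (u - j * s) / c = 1 / (s * c) * (j - y₀) := by
    intro j
    rw [hy₀]
    field_simp
    linear_combination j * hcs
  have hr : ∀ j : ℝ, (j * c - v) / s - (u + W - j * s) / c = 1 / (s * c) * (j - y₁) := by
    intro j
    rw [hy₁, hy₀]
    field_simp
    linear_combination j * hcs
  have hl : ∀ j : ℝ, (j * c - v - H) / s - (u - j * s) / c = 1 / (s * c) * (j - y₂) := by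
    intro j
    rw [hy₂, hy₀]
    field_simp
    linear_combination j * hcs
  have hκ : 0 < 1 / (s * c) := by positivity
  have hhi' : ∀ j : ℤ, hi j = (j * c - v) / s - 1 / (s * c) * max ((j : ℝ) - y₁) 0 := by
    intro j
    have := hr j
    simp only [hhi]
    rcases le_total (j : ℝ) y₁ with h | h
    · rw [max_eq_right (by linarith), min_eq_left (by nlinarith)]; ring
    · rw [max_eq_left (by linarith), min_eq_right (by nlinarith)]; linarith
  have hlo' : ∀ j : ℤ, lo j = (u - j * s) / c + 1 / (s * c) * max ((j : ℝ) - y₂) 0 := by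
    intro j
    have := hl j
    simp only [hlo]
    rcases le_total (j : ℝ) y₂ with h | h
    · rw [max_eq_right (a := (j : ℝ) - y₂) (by linarith), max_eq_left (by nlinarith)]; ring
    · rw [max_eq_left (a := (j : ℝ) - y₂) (by linarith), max_eq_right (by nlinarith)]; linarith
  have hdiff : ∀ j : ℤ, y₀ ≤ j → (j : ℝ) ≤ y₃ → hi j - lo j = 1 / (s * c) *
      (max ((j : ℝ) - y₀) 0 - max ((j : ℝ) - y₁) 0 - max ((j : ℝ) - y₂) 0
        + max ((j : ℝ) - y₃) 0) := by
    intro j h0 h3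
    rw [hhi', hlo', max_eq_left (a := (j : ℝ) - y₀) (by linarith),
      max_eq_right (a := (j : ℝ) - y₃) (by linarith)]
    linarith [hgap j]
  have hnonneg : ∀ j : ℤ, y₀ ≤ j → (j : ℝ) ≤ y₃ → lo j ≤ hi j := by
    intro j h0 h3
    have h := hdiff j h0 h3
    have : 0 ≤ max ((j : ℝ) - y₀) 0 - max ((j : ℝ) - y₁) 0 - max ((j : ℝ) - y₂) 0
        + max ((j : ℝ) - y₃) 0 := by
      rcases max_cases ((j : ℝ) - y₀) 0 with h0 | h0 <;>
      rcases max_cases ((j : ℝ) - y₁) 0 with h1 | h1 <;>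
      rcases max_cases ((j : ℝ) - y₂) 0 with h2 | h2 <;>
      rcases max_cases ((j : ℝ) - y₃) 0 with h3 | h3 <;> linarith
    nlinarith [mul_nonneg hκ.le this]
  let swap : (Σ _ : ℤ, ℤ) ↪ ℤ × ℤ :=
    ⟨fun x => (x.2, x.1), by
      rintro ⟨a, b⟩ ⟨a', b'⟩ h
      simp only [Prod.mk.injEq] at h
      obtain ⟨rfl, rfl⟩ := h
      rfl⟩
  refine ⟨((Finset.Icc A E).sigma fun j => Finset.Icc ⌈lo j⌉ ⌊hi j⌋).map swap, ?_, ?_⟩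
  · rintro ⟨i, j⟩
    have hmem : (i, j) ∈ ((Finset.Icc A E).sigma fun j => Finset.Icc ⌈lo j⌉ ⌊hi j⌋).map swap ↔
        (A ≤ j ∧ j ≤ E) ∧ ⌈lo j⌉ ≤ i ∧ i ≤ ⌊hi j⌋ := by
      rw [Finset.mem_map]
      constructor
      · rintro ⟨⟨a, b⟩, h, h'⟩
        cases h'
        simpa using h
      · intro h
        exact ⟨⟨j, i⟩, by simpa using h, rfl⟩
    rw [hmem, hA, hE, Int.ceil_le, Int.le_floor, Int.ceil_le, Int.le_floor]
    simp only [hlo, hhi, max_le_iff, le_min_iff, div_le_iff₀ hc, div_le_iff₀ hs, le_div_iff₀ hc,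
      le_div_iff₀ hs]
    constructor
    · rintro ⟨-, ⟨h1, h2⟩, h3, h4⟩
      refine ⟨⟨?_, ?_⟩, ?_, ?_⟩ <;> linarith
    · rintro ⟨⟨h1, h2⟩, h3, h4⟩
      have e : (j : ℝ) = s * (i * c + j * s) + c * (j * c - i * s) := by
        linear_combination (-j : ℝ) * hcs
      refine ⟨⟨?_, ?_⟩, ⟨?_, ?_⟩, ?_, ?_⟩ <;> try linarith
      · rw [e, hy₀]; gcongr
      · rw [e, hy₃, hy₀]
        have := mul_le_mul_of_nonneg_left h2 hs.le
        have := mul_le_mul_of_nonneg_left h4 hc.le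
        linarith
  · rw [Finset.card_map, Finset.card_sigma, Nat.cast_sum]
    have hrow : ∀ j ∈ Finset.Icc A E, ((Finset.Icc ⌈lo j⌉ ⌊hi j⌋).card : ℝ)
        = saw (hi j) + saw (-lo j) + 1 / (s * c) *
      (max ((j : ℝ) - y₀) 0 - max ((j : ℝ) - y₁) 0 - max ((j : ℝ) - y₂) 0
        + max ((j : ℝ) - y₃) 0) := by
      intro j hj
      rw [Finset.mem_Icc] at hj
      have hj0 : y₀ ≤ j := Int.ceil_le.1 hj.1
      have hj3 : (j : ℝ) ≤ y₃ := Int.le_floor.1 hj.2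
      have hle := hnonneg j hj0 hj3
      have h1 : ⌊lo j⌋ ≤ ⌊hi j⌋ := Int.floor_le_floor hle
      have h2 := Int.ceil_le_floor_add_one (lo j)
      rw [← hdiff j hj0 hj3, Int.card_Icc]
      have h3 : (((⌊hi j⌋ + 1 - ⌈lo j⌉).toNat : ℤ) : ℝ) = ((⌊hi j⌋ + 1 - ⌈lo j⌉ : ℤ) : ℝ) := by
        rw [Int.toNat_of_nonneg (by omega)]
      rw [Int.cast_natCast] at h3
      rw [h3, saw, saw, Int.fract, Int.fract, Int.floor_neg]
      push_cast
      ring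
    rw [Finset.sum_congr rfl hrow, Int.Icc_eq_finset_map, Finset.sum_map, hK, Int.toNat_natCast]
    simp only [Function.Embedding.trans_apply, Nat.castEmbedding_apply, addLeftEmbedding_apply,
      Int.cast_add, Int.cast_natCast]
    rw [Finset.sum_add_distrib, Finset.sum_add_distrib]
    have hshift : ∀ (n : ℕ) (y : ℝ), (A : ℝ) + n - y = n - (y - A) := by intro n y; ring
    have hsaw_hi : |∑ n ∈ Finset.range K, saw (hi (A + (n : ℤ)))| ≤ 2 * B := by
      have h := abs_sum_saw_ite (K := K) (B := B) (β₁ := c / s) (β₂ := -(s / c))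
        (fun M hM => hB _ (by simp) M ((Nat.cast_le.2 hM).trans hKle))
        (fun M hM => hB _ (by simp) M ((Nat.cast_le.2 hM).trans hKle))
        ((A * c - v) / s) ((u + W - A * s) / c) (y₁ - A)
      convert h using 3 with n _
      congr 1
      have hh := hr (A + n)
      rw [hhi']
      push_cast
      split_ifs with hlt
      · rw [max_eq_right (by linarith)]; ring
      · rw [max_eq_left (by linarith), ← hh]; ring
    have hsaw_lo : |∑ n ∈ Finset.range K, saw (-lo (A + (n : ℤ)))| ≤ 2 * B := by
      have h := abs_sum_saw_ite (K := K) (B := B) (β₁ := s / c) (β₂ := -(c / s))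
        (fun M hM => hB _ (by simp) M ((Nat.cast_le.2 hM).trans hKle))
        (fun M hM => hB _ (by simp) M ((Nat.cast_le.2 hM).trans hKle))
        ((A * s - u) / c) ((v + H - A * c) / s) (y₂ - A)
      convert h using 3 with n _
      congr 1
      have hh := hl (A + n)
      rw [hlo']
      push_cast
      split_ifs with hlt
      · rw [max_eq_right (by linarith)]; ring
      · rw [max_eq_left (by linarith), ← hh]; ring
    have hramp : |∑ n ∈ Finset.range K, 1 / (s * c) *
        (max ((A : ℝ) + n - y₀) 0 - max ((A : ℝ) + n - y₁) 0 - max ((A : ℝ) + n - y₂) 0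
        + max ((A : ℝ) + n - y₃) 0) - W * H| ≤ 1 / (s * c) := by
      simp_rw [hshift]
      rw [← Finset.mul_sum, Finset.sum_add_distrib, Finset.sum_sub_distrib,
        Finset.sum_sub_distrib]
      have r0 := abs_le.1 (abs_sum_ramp K (y := y₀ - A) (by linarith) (by linarith))
      have r1 := abs_le.1 (abs_sum_ramp K (y := y₁ - A) (by linarith) (by linarith))
      have r2 := abs_le.1 (abs_sum_ramp K (y := y₂ - A) (by linarith) (by linarith))
      have r3 := abs_le.1 (abs_sum_ramp K (y := y₃ - A) (by linarith) (by linarith))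
      set R0 := ∑ n ∈ Finset.range K, max ((n : ℝ) - (y₀ - A)) 0
      set R1 := ∑ n ∈ Finset.range K, max ((n : ℝ) - (y₁ - A)) 0
      set R2 := ∑ n ∈ Finset.range K, max ((n : ℝ) - (y₂ - A)) 0
      set R3 := ∑ n ∈ Finset.range K, max ((n : ℝ) - (y₃ - A)) 0
      have e : 1 / (s * c) * (R0 - R1 - R2 + R3) - W * H
          = 1 / (s * c) * (R0 - R1 - R2 + R3 - s * W * (c * H)) := by field_simp
      rw [e, abs_mul, abs_of_pos hκ]
      refine mul_le_of_le_one_right hκ.le (abs_le.2 ?_)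
      obtain ⟨r0, r0'⟩ := r0
      obtain ⟨r1, r1'⟩ := r1
      obtain ⟨r2, r2'⟩ := r2
      obtain ⟨r3, r3'⟩ := r3
      have key : (((K : ℝ) - 1 - (y₀ - A)) ^ 2 + ((K : ℝ) - 1 - (y₀ - A))) / 2
          - (((K : ℝ) - 1 - (y₁ - A)) ^ 2 + ((K : ℝ) - 1 - (y₁ - A))) / 2
          - (((K : ℝ) - 1 - (y₂ - A)) ^ 2 + ((K : ℝ) - 1 - (y₂ - A))) / 2
          + (((K : ℝ) - 1 - (y₃ - A)) ^ 2 + ((K : ℝ) - 1 - (y₃ - A))) / 2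
          = s * W * (c * H) := by
        rw [hy₁, hy₂, hy₃]; ring
      constructor <;> linarith
    rw [add_sub_assoc]
    refine (abs_add_le _ _).trans ?_
    have := abs_add_le (∑ n ∈ Finset.range K, saw (hi (A + (n : ℤ))))
      (∑ n ∈ Finset.range K, saw (-lo (A + (n : ℤ))))
    linarith

/-- The direction `x` stays away from all rational directions `(p, q)`, with constant `c` and
exponent `1 + σ`. -/
def AngleBad (c σ x : ℝ) : Prop :=
  ∀ p q : ℤ, (p ≠ 0 ∨ q ≠ 0) →
    c * (max |(p : ℝ)| |(q : ℝ)|) ^ (-(1 + σ)) ≤ |q * Real.sin x - p * Real.cos x|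

lemma volume_near_zero_of_form_le {a b m δ : ℝ} (hm : 0 < m) (hma : m ^ 2 ≤ a ^ 2 + b ^ 2)
    (hδ : δ ≤ 1 / 6) (x : ℝ) :
    volume {α : ℝ | α ∈ Set.Icc (0 : ℝ) 1 ∧
      |a * Real.sin (x - α) - b * Real.cos (x - α)| ≤ 3 * (m * δ)} ≤ ENNReal.ofReal (24 * δ) := by
  refine (Real.volume_le_diam _).trans (Metric.ediam_le ?_)
  rintro α ⟨hα, hfα⟩ α' ⟨hα', hfα'⟩
  rw [edist_dist, Real.dist_eq]
  refine ENNReal.ofReal_le_ofReal ?_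
  set t := α - α' with ht
  set f := a * Real.sin (x - α) - b * Real.cos (x - α) with hf
  set g := a * Real.cos (x - α) + b * Real.sin (x - α) with hg
  have hf' : a * Real.sin (x - α') - b * Real.cos (x - α') = f * Real.cos t + g * Real.sin t := by
    have : x - α' = (x - α) + t := by rw [ht]; ring
    rw [this, Real.sin_add, Real.cos_add, hf, hg]; ring
  rw [hf'] at hfα'
  have hfg : f ^ 2 + g ^ 2 = a ^ 2 + b ^ 2 := by
    have h := Real.sin_sq_add_cos_sq (x - α)
    rw [hf, hg]
    linear_combination (a ^ 2 + b ^ 2) * h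
  have hmδ : 3 * (m * δ) ≤ m / 2 := by nlinarith
  have hf2 : f ^ 2 ≤ (m / 2) ^ 2 := by
    rw [← sq_abs f]
    exact pow_le_pow_left₀ (abs_nonneg _) (hfα.trans hmδ) 2
  have hg2 : m / 2 ≤ |g| := by
    refine le_of_sq_le_sq ?_ (abs_nonneg g)
    rw [sq_abs]
    nlinarith
  have hgs : |g| * |Real.sin t| ≤ 6 * (m * δ) := by
    rw [← abs_mul]
    have e : g * Real.sin t = (f * Real.cos t + g * Real.sin t) - f * Real.cos t := by ring
    rw [e]
    refine (abs_sub _ _).trans ?_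
    have : |f * Real.cos t| ≤ |f| := by
      rw [abs_mul]
      exact mul_le_of_le_one_right (abs_nonneg _) (Real.abs_cos_le_one t)
    linarith
  have hst : |Real.sin t| ≤ 12 * δ := by
    have h := (mul_le_mul_of_nonneg_right hg2 (abs_nonneg (Real.sin t))).trans hgs
    have : m * |Real.sin t| ≤ m * (12 * δ) := by linarith
    exact le_of_mul_le_mul_left this hm
  have htπ : |t| ≤ Real.pi / 2 := by
    have : |t| ≤ 1 := by rw [abs_le, ht]; constructor <;> linarith [hα.1, hα.2, hα'.1, hα'.2]
    linarith [Real.pi_gt_three]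
  have h := Real.mul_abs_le_abs_sin htπ
  have hπ : 1 / 2 * |t| ≤ 2 / Real.pi * |t| := by
    refine mul_le_mul_of_nonneg_right ?_ (abs_nonneg t)
    rw [div_le_div_iff₀ (by norm_num) Real.pi_pos]
    linarith [Real.pi_le_four]
  linarith

lemma volume_bad_angles_le {Ω : Set ℝ} {s C c σ : ℝ} (hs0 : 0 ≤ s)
    (hcov : ∀ δ : ℝ, 0 < δ → δ < 1 → ∃ F : Finset ℝ, (F.card : ℝ) ≤ C * δ ^ (-s) ∧
      Ω ⊆ ⋃ x ∈ F, Set.Icc x (x + δ))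
    (hc : 0 < c) (hc6 : c ≤ 1 / 6) (hσ : 0 < σ) {a b m : ℝ} (hm1 : 1 ≤ m)
    (ha : |a| ≤ m) (hb : |b| ≤ m) (hma : m ^ 2 ≤ a ^ 2 + b ^ 2) :
    volume {α : ℝ | α ∈ Set.Icc (0 : ℝ) 1 ∧ ∃ θ, (θ ∈ Ω ∨ θ = 0) ∧
      |a * Real.sin (θ - α) - b * Real.cos (θ - α)| < c * m ^ (-(1 + σ))}
      ≤ ENNReal.ofReal (24 * (C + 1) * c ^ (1 - s) * m ^ (-((2 + σ) * (1 - s)))) := by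
  have hm : 0 < m := by linarith
  set δ := c * m ^ (-(2 + σ)) with hδ
  have hδ0 : 0 < δ := by positivity
  have hδ6 : δ ≤ 1 / 6 := by
    have : m ^ (-(2 + σ)) ≤ 1 := Real.rpow_le_one_of_one_le_of_nonpos hm1 (by linarith)
    nlinarith
  have hmδ : c * m ^ (-(1 + σ)) = m * δ := by
    have : -(1 + σ) = 1 + -(2 + σ) := by ring
    rw [this, Real.rpow_add hm, Real.rpow_one, hδ]; ring
  obtain ⟨F, hF, hΩF⟩ := hcov δ hδ0 (by linarith)
  have hsub : {α : ℝ | α ∈ Set.Icc (0 : ℝ) 1 ∧ ∃ θ, (θ ∈ Ω ∨ θ = 0) ∧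
      |a * Real.sin (θ - α) - b * Real.cos (θ - α)| < c * m ^ (-(1 + σ))}
      ⊆ ⋃ x ∈ insert 0 F, {α : ℝ | α ∈ Set.Icc (0 : ℝ) 1 ∧
        |a * Real.sin (x - α) - b * Real.cos (x - α)| ≤ 3 * (m * δ)} := by
    rintro α ⟨hα, θ, hθ, hlt⟩
    rw [hmδ] at hlt
    obtain ⟨x, hxF, hx1, hx2⟩ : ∃ x ∈ insert 0 F, x ≤ θ ∧ θ ≤ x + δ := by
      rcases hθ with h | rfl
      · have := hΩF h
        simp only [Set.mem_iUnion, Set.mem_Icc] at this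
        obtain ⟨x, hx, h1, h2⟩ := this
        exact ⟨x, Finset.mem_insert_of_mem hx, h1, h2⟩
      · exact ⟨0, Finset.mem_insert_self _ _, le_rfl, by linarith⟩
    refine Set.mem_biUnion (Finset.mem_coe.2 hxF) ⟨hα, ?_⟩
    have hd : |(x - α) - (θ - α)| ≤ δ := by rw [abs_le]; constructor <;> linarith
    have h1 := (Real.abs_sin_sub_sin_le (x - α) (θ - α)).trans hd
    have h2 := (Real.abs_cos_sub_cos_le (x - α) (θ - α)).trans hd
    have e : a * Real.sin (x - α) - b * Real.cos (x - α)
        = (a * Real.sin (θ - α) - b * Real.cos (θ - α))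
          + a * (Real.sin (x - α) - Real.sin (θ - α))
          - b * (Real.cos (x - α) - Real.cos (θ - α)) := by ring
    have h3 : |a * (Real.sin (x - α) - Real.sin (θ - α))| ≤ m * δ := by
      rw [abs_mul]; gcongr
    have h4 : |b * (Real.cos (x - α) - Real.cos (θ - α))| ≤ m * δ := by
      rw [abs_mul]; gcongr
    rw [e]
    refine (abs_sub _ _).trans ?_
    have := abs_add_le (a * Real.sin (θ - α) - b * Real.cos (θ - α))
      (a * (Real.sin (x - α) - Real.sin (θ - α)))
    linarith
  refine (measure_mono hsub).trans ((measure_biUnion_finset_le _ _).trans ?_)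
  refine (Finset.sum_le_sum fun x _ =>
    volume_near_zero_of_form_le hm hma hδ6 x).trans ?_
  rw [Finset.sum_const, nsmul_eq_mul, ← ENNReal.ofReal_natCast,
    ← ENNReal.ofReal_mul (Nat.cast_nonneg _)]
  refine ENNReal.ofReal_le_ofReal ?_
  have hcard : ((insert 0 F).card : ℝ) ≤ (C + 1) * δ ^ (-s) := by
    have h1 : ((insert 0 F).card : ℝ) ≤ F.card + 1 := by exact_mod_cast Finset.card_insert_le _ _
    have h2 : 1 ≤ δ ^ (-s) :=
      Real.one_le_rpow_of_pos_of_le_one_of_nonpos hδ0 (by linarith) (by linarith)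
    linarith
  have hpow : δ ^ (-s) * δ = c ^ (1 - s) * m ^ (-((2 + σ) * (1 - s))) := by
    have e : δ ^ (-s) * δ = δ ^ (1 - s) := by
      rw [← Real.rpow_add_one hδ0.ne']; congr 1; ring
    rw [e, hδ, Real.mul_rpow hc.le (by positivity), ← Real.rpow_mul hm.le, neg_mul]
  calc ((insert 0 F).card : ℝ) * (24 * δ) ≤ (C + 1) * δ ^ (-s) * (24 * δ) := by gcongr
    _ = 24 * (C + 1) * (δ ^ (-s) * δ) := by ring
    _ = _ := by rw [hpow]; ring

lemma exists_angleBad {Ω : Set ℝ} {d σ : ℝ} (hd0 : 0 ≤ d) (hmink : MinkowskiBound Ω d)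
    (hσ : 0 < σ) (hdσ : 2 < (2 + σ) * (1 - d)) :
    ∃ c : ℝ, 0 < c ∧ c ≤ 1 ∧ ∃ α ∈ Set.Icc (0 : ℝ) 1,
      ∀ θ, (θ ∈ Ω ∨ θ = 0) → AngleBad c σ (θ - α) := by
  obtain ⟨s, hds, hs⟩ : ∃ s, d < s ∧ s < 1 - 2 / (2 + σ) := by
    apply exists_between
    have : 2 / (2 + σ) < 1 - d := by rw [div_lt_iff₀ (by linarith)]; linarith
    linarith
  have hs0 : 0 ≤ s := by linarith
  have hκ : 2 < (2 + σ) * (1 - s) := by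
    have : 2 / (2 + σ) < 1 - s := by linarith
    rw [div_lt_iff₀ (by linarith)] at this
    linarith
  have hs1 : 0 < 1 - s := by nlinarith
  obtain ⟨Cs, hCs⟩ := hmink s hds
  have hcov : ∀ δ : ℝ, 0 < δ → δ < 1 → ∃ F : Finset ℝ, (F.card : ℝ) ≤ |Cs| * δ ^ (-s) ∧
      Ω ⊆ ⋃ x ∈ F, Set.Icc x (x + δ) := by
    intro δ h0 h1
    obtain ⟨F, hF, hsub⟩ := hCs δ h0 h1
    refine ⟨F, hF.trans ?_, hsub⟩
    gcongr
    exact le_abs_self _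
  set κ := (2 + σ) * (1 - s) with hκdef
  have hsum := EisensteinSeries.summable_one_div_norm_rpow hκ
  set S := ∑' v : Fin 2 → ℤ, ‖v‖ ^ (-κ) with hS
  have hS0 : 0 ≤ S := tsum_nonneg fun v => by positivity
  set D := 24 * (|Cs| + 1) with hD
  have hD0 : 0 < D := by positivity
  set e := 1 / (2 * D * (S + 1)) with he
  have he0 : 0 < e := by positivity
  set c := min (1 / 6) (e ^ (1 / (1 - s))) with hc
  have hc0 : 0 < c := lt_min (by norm_num) (by positivity)
  have hc6 : c ≤ 1 / 6 := min_le_left _ _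
  have hce : c ^ (1 - s) ≤ e := by
    calc c ^ (1 - s) ≤ (e ^ (1 / (1 - s))) ^ (1 - s) := by
          gcongr
          exact min_le_right _ _
      _ = e := by
          rw [← Real.rpow_mul he0.le, one_div_mul_cancel hs1.ne', Real.rpow_one]
  refine ⟨c, hc0, by linarith, ?_⟩
  set bad : (Fin 2 → ℤ) → Set ℝ := fun v => {α | v ≠ 0 ∧ α ∈ Set.Icc (0 : ℝ) 1 ∧
    ∃ θ, (θ ∈ Ω ∨ θ = 0) ∧ |(v 1 : ℝ) * Real.sin (θ - α) - (v 0 : ℝ) * Real.cos (θ - α)|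
      < c * ‖v‖ ^ (-(1 + σ))} with hbad
  have hnorm : ∀ v : Fin 2 → ℤ, ‖v‖ = max |(v 0 : ℝ)| |(v 1 : ℝ)| := by
    intro v
    rw [EisensteinSeries.norm_eq_max_natAbs, Nat.cast_max, Nat.cast_natAbs, Nat.cast_natAbs,
      Int.cast_abs, Int.cast_abs]
  have hvol : ∀ v, volume (bad v) ≤ ENNReal.ofReal (D * c ^ (1 - s) * ‖v‖ ^ (-κ)) := by
    intro v
    by_cases hv : v = 0
    · have : bad v = ∅ := by ext α; simp [hbad, hv]
      rw [this, measure_empty]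
      exact zero_le
    · have h1 : 1 ≤ ‖v‖ := by
        rw [EisensteinSeries.norm_eq_max_natAbs]
        have : 1 ≤ max (v 0).natAbs (v 1).natAbs := by
          by_contra! hlt
          apply hv
          ext i
          fin_cases i <;> simp <;> omega
        exact_mod_cast this
      have h2 : ‖v‖ ^ 2 ≤ (v 1 : ℝ) ^ 2 + (v 0 : ℝ) ^ 2 := by
        rw [hnorm]
        rcases max_cases |(v 0 : ℝ)| |(v 1 : ℝ)| with ⟨h, _⟩ | ⟨h, _⟩ <;> rw [h, sq_abs] <;>
          nlinarith [sq_nonneg (v 0 : ℝ), sq_nonneg (v 1 : ℝ)]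
      refine (measure_mono ?_).trans (volume_bad_angles_le hs0 hcov hc0 hc6 hσ h1
        (by rw [hnorm]; exact le_max_right _ _) (by rw [hnorm]; exact le_max_left _ _) h2)
      rintro α ⟨-, h⟩
      exact h
  have htotal : volume (⋃ v, bad v) < volume (Set.Icc (0 : ℝ) 1) := by
    calc volume (⋃ v, bad v) ≤ ∑' v, volume (bad v) := measure_iUnion_le _
      _ ≤ ∑' v : Fin 2 → ℤ, ENNReal.ofReal (D * c ^ (1 - s) * ‖v‖ ^ (-κ)) :=
          ENNReal.tsum_le_tsum hvol
      _ = ENNReal.ofReal (D * c ^ (1 - s) * S) := by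
          rw [← ENNReal.ofReal_tsum_of_nonneg (fun v => by positivity) (hsum.mul_left _),
            tsum_mul_left]
      _ < ENNReal.ofReal 1 := by
          rw [ENNReal.ofReal_lt_ofReal_iff one_pos]
          calc D * c ^ (1 - s) * S ≤ D * e * (S + 1) := by gcongr; linarith
            _ = 1 / 2 := by rw [he]; field_simp
            _ < 1 := by norm_num
      _ = volume (Set.Icc (0 : ℝ) 1) := by rw [Real.volume_Icc]; norm_num
  obtain ⟨α, hα, hαbad⟩ : ∃ α ∈ Set.Icc (0 : ℝ) 1, α ∉ ⋃ v, bad v := by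
    by_contra! h
    exact absurd (measure_mono h) (not_le.2 htotal)
  refine ⟨α, hα, fun θ hθ p q hpq => ?_⟩
  by_contra! hlt
  apply hαbad
  refine Set.mem_iUnion.2 ⟨![p, q], ?_, hα, θ, hθ, ?_⟩
  · intro h
    have h0 := congrFun h 0
    have h1 := congrFun h 1
    simp at h0 h1
    tauto
  · rw [hnorm]
    simpa using hlt

lemma DiophBad.neg {c σ β : ℝ} (h : DiophBad c σ β) : DiophBad c σ (-β) := by
  intro q hq p
  have := h q hq (-p)
  rwa [← abs_neg, show -(q * β - ((-p : ℤ) : ℝ)) = q * (-β) - p by push_cast; ring] at this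

lemma diophBad_div {c σ a b : ℝ} (hc : 0 < c) (hc1 : c ≤ 1) (hσ : 0 < σ) (ha : |a| ≤ 1)
    (hb : |b| ≤ 1) (hcb : c ≤ |b|)
    (h : ∀ (q : ℕ) (p : ℤ), 0 < q →
      c * (max |(p : ℝ)| (q : ℝ)) ^ (-(1 + σ)) ≤ |q * a - p * b|) :
    DiophBad (c * (1 / c + 1) ^ (-(1 + σ))) σ (a / b) := by
  intro q hq p
  have hq1 : (1 : ℝ) ≤ q := by exact_mod_cast hq
  have hb0 : 0 < |b| := hc.trans_le hcb
  have hbne : b ≠ 0 := abs_pos.1 hb0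
  set D := 1 / c + 1 with hD
  have hD1 : 1 ≤ D := by rw [hD]; have : 0 < 1 / c := by positivity
                         linarith
  rcases le_or_gt |(p : ℝ)| (D * q) with hp | hp
  · have hmax : max |(p : ℝ)| (q : ℝ) ≤ D * q := max_le hp (by nlinarith)
    have hmax0 : 0 < max |(p : ℝ)| (q : ℝ) := lt_max_of_lt_right (by linarith)
    calc c * D ^ (-(1 + σ)) * (q : ℝ) ^ (-(1 + σ)) = c * (D * q) ^ (-(1 + σ)) := by
          rw [Real.mul_rpow (by linarith) (by linarith)]; ring
      _ ≤ c * (max |(p : ℝ)| (q : ℝ)) ^ (-(1 + σ)) := by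
          gcongr c * ?_
          exact Real.rpow_le_rpow_of_nonpos hmax0 hmax (by linarith)
      _ ≤ |q * a - p * b| := h q p hq
      _ = |q * (a / b) - p| * |b| := by rw [← abs_mul]; congr 1; field_simp
      _ ≤ |q * (a / b) - p| := mul_le_of_le_one_right (abs_nonneg _) hb
  · have h1 : |q * (a / b)| ≤ q * (1 / c) := by
      rw [abs_mul, Nat.abs_cast, abs_div]
      gcongr
    have h2 := abs_sub_abs_le_abs_sub (p : ℝ) (q * (a / b))
    rw [abs_sub_comm] at h2
    have h3 : (1 : ℝ) ≤ |q * (a / b) - p| := by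
      have : D * q = q * (1 / c) + q := by rw [hD]; ring
      linarith
    have h4 : D ^ (-(1 + σ)) ≤ 1 := Real.rpow_le_one_of_one_le_of_nonpos hD1 (by linarith)
    have h5 : (q : ℝ) ^ (-(1 + σ)) ≤ 1 := Real.rpow_le_one_of_one_le_of_nonpos hq1 (by linarith)
    calc c * D ^ (-(1 + σ)) * (q : ℝ) ^ (-(1 + σ)) ≤ 1 * 1 * 1 := by gcongr
      _ ≤ _ := by linarith

lemma AngleBad.add_pi_div_two {c σ x : ℝ} (h : AngleBad c σ x) :
    AngleBad c σ (x + Real.pi / 2) := by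
  intro p q hpq
  have := h (-q) p (by omega)
  rw [Real.sin_add_pi_div_two, Real.cos_add_pi_div_two]
  push_cast at this
  rw [abs_neg, max_comm] at this
  convert this using 2
  ring

lemma AngleBad.le_abs_sin {c σ x : ℝ} (h : AngleBad c σ x) : c ≤ |Real.sin x| := by
  simpa using h 0 1 (by simp)

lemma AngleBad.le_abs_cos {c σ x : ℝ} (h : AngleBad c σ x) : c ≤ |Real.cos x| := by
  simpa using h 1 0 (by simp)

lemma AngleBad.diophBad_tan {c σ x : ℝ} (h : AngleBad c σ x) (hc : 0 < c) (hc1 : c ≤ 1)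
    (hσ : 0 < σ) :
    DiophBad (c * (1 / c + 1) ^ (-(1 + σ))) σ (Real.sin x / Real.cos x) := by
  refine diophBad_div hc hc1 hσ (Real.abs_sin_le_one x) (Real.abs_cos_le_one x) h.le_abs_cos ?_
  intro q p hq
  simpa using h p q (Or.inr (by positivity))

lemma AngleBad.diophBad_cot {c σ x : ℝ} (h : AngleBad c σ x) (hc : 0 < c) (hc1 : c ≤ 1)
    (hσ : 0 < σ) :
    DiophBad (c * (1 / c + 1) ^ (-(1 + σ))) σ (Real.cos x / Real.sin x) := by
  refine diophBad_div hc hc1 hσ (Real.abs_cos_le_one x) (Real.abs_sin_le_one x) h.le_abs_sin ?_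
  intro q p hq
  have := h q p (Or.inl (by positivity))
  rw [max_comm, abs_sub_comm]
  simpa using this

lemma exists_lattice_count_of_angleBad {c σ : ℝ} (hc : 0 < c) (hc1 : c ≤ 1) (hσ : 0 < σ) :
    ∃ K : ℝ, 0 < K ∧ ∀ x : ℝ, AngleBad c σ x → 0 ≤ Real.cos x →
      ∀ L W H : ℝ, 1 ≤ L → 0 ≤ W → W ≤ L → 0 ≤ H → H ≤ L → ∀ u v : ℝ,
      ∃ S : Finset (ℤ × ℤ),
        (∀ z : ℤ × ℤ, z ∈ S ↔
          (u ≤ z.1 * Real.cos x + z.2 * Real.sin x ∧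
            z.1 * Real.cos x + z.2 * Real.sin x ≤ u + W) ∧
          (v ≤ z.2 * Real.cos x - z.1 * Real.sin x ∧
            z.2 * Real.cos x - z.1 * Real.sin x ≤ v + H)) ∧
        |(S.card : ℝ) - W * H| ≤ K * L ^ (σ / (1 + σ)) := by
  set c' := c * (1 / c + 1) ^ (-(1 + σ)) with hc'
  have hc'0 : 0 < c' := by positivity
  obtain ⟨K₀, hK₀, hsaw⟩ := abs_sum_saw_le hc'0 hσ
  set a := σ / (1 + σ) with ha
  have ha0 : 0 < a := by positivity
  refine ⟨1 / c ^ 2 + 4 * (K₀ * 3 ^ a), by positivity, ?_⟩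
  have main : ∀ x : ℝ, AngleBad c σ x → 0 < Real.cos x → 0 < Real.sin x →
      ∀ L W H : ℝ, 1 ≤ L → 0 ≤ W → W ≤ L → 0 ≤ H → H ≤ L → ∀ u v : ℝ,
      ∃ S : Finset (ℤ × ℤ),
        (∀ z : ℤ × ℤ, z ∈ S ↔
          (u ≤ z.1 * Real.cos x + z.2 * Real.sin x ∧
            z.1 * Real.cos x + z.2 * Real.sin x ≤ u + W) ∧
          (v ≤ z.2 * Real.cos x - z.1 * Real.sin x ∧
            z.2 * Real.cos x - z.1 * Real.sin x ≤ v + H)) ∧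
        |(S.card : ℝ) - W * H| ≤ (1 / c ^ 2 + 4 * (K₀ * 3 ^ a)) * L ^ a := by
    intro x hx hcos hsin L W H hL hW hWL hH hHL u v
    have htan := hx.diophBad_tan hc hc1 hσ
    have hcot := hx.diophBad_cot hc hc1 hσ
    have hdio : ∀ β : ℝ, β = Real.cos x / Real.sin x ∨ β = -(Real.sin x / Real.cos x) ∨
        β = Real.sin x / Real.cos x ∨ β = -(Real.cos x / Real.sin x) → DiophBad c' σ β := by
      rintro β (rfl | rfl | rfl | rfl)
      exacts [hcot, htan.neg, htan, hcot.neg]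
    obtain ⟨S, hS, hcard⟩ := exists_lattice_count (B := K₀ * (3 * L) ^ a) hcos hsin
      (Real.cos_sq_add_sin_sq x) hW hH
      (fun β hβ M hM γ => (hsaw β (hdio β hβ) M γ).trans (by gcongr; linarith)) u v
    refine ⟨S, hS, hcard.trans ?_⟩
    have h1 := hx.le_abs_sin
    have h2 := hx.le_abs_cos
    rw [abs_of_pos hsin] at h1
    rw [abs_of_pos hcos] at h2
    have h3 : 1 / (Real.sin x * Real.cos x) ≤ 1 / c ^ 2 * L ^ a := by
      calc 1 / (Real.sin x * Real.cos x) ≤ 1 / c ^ 2 := by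
            apply one_div_le_one_div_of_le (by positivity)
            rw [sq]; gcongr
        _ ≤ 1 / c ^ 2 * L ^ a :=
            le_mul_of_one_le_right (by positivity) (Real.one_le_rpow hL ha0.le)
    rw [Real.mul_rpow (by norm_num) (by linarith)]
    linarith
  intro x hx hcos L W H hL hW hWL hH hHL u v
  have hcos' : 0 < Real.cos x := by
    have := hx.le_abs_cos
    rw [abs_of_nonneg hcos] at this
    linarith
  have hsin : Real.sin x ≠ 0 := abs_pos.1 (hc.trans_le hx.le_abs_sin)
  rcases lt_or_gt_of_ne hsin with hneg | hpos
  · obtain ⟨S, hS, hcard⟩ := main (x + Real.pi / 2) hx.add_pi_div_two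
      (by rw [Real.cos_add_pi_div_two]; linarith) (by rwa [Real.sin_add_pi_div_two])
      L H W hL hH hHL hW hWL v (-u - W)
    refine ⟨S, fun z => (hS z).trans ?_, by rwa [mul_comm W H]⟩
    rw [Real.cos_add_pi_div_two, Real.sin_add_pi_div_two]
    constructor
    · rintro ⟨⟨h1, h2⟩, h3, h4⟩
      refine ⟨⟨?_, ?_⟩, ?_, ?_⟩ <;> linarith
    · rintro ⟨⟨h1, h2⟩, h3, h4⟩
      refine ⟨⟨?_, ?_⟩, ?_, ?_⟩ <;> linarith
  · exact main x hx hcos' hpos L W H hL hW hWL hH hHL u v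

lemma mem_rect {φ w h : ℝ} {p z : ℝ × ℝ} :
    z ∈ rect φ p w h ↔
      (0 ≤ (z.1 - p.1) * Real.cos φ + (z.2 - p.2) * Real.sin φ ∧
        (z.1 - p.1) * Real.cos φ + (z.2 - p.2) * Real.sin φ ≤ w) ∧
      (0 ≤ (z.2 - p.2) * Real.cos φ - (z.1 - p.1) * Real.sin φ ∧
        (z.2 - p.2) * Real.cos φ - (z.1 - p.1) * Real.sin φ ≤ h) := by
  have hcs := Real.sin_sq_add_cos_sq φ
  constructor
  · rintro ⟨y, ⟨⟨h1, h2⟩, h3, h4⟩, rfl⟩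
    simp only [rot, Prod.fst_add, Prod.snd_add, add_sub_cancel_left]
    have e1 : (y.1 * Real.cos φ - y.2 * Real.sin φ) * Real.cos φ
        + (y.1 * Real.sin φ + y.2 * Real.cos φ) * Real.sin φ = y.1 := by
      linear_combination y.1 * hcs
    have e2 : (y.1 * Real.sin φ + y.2 * Real.cos φ) * Real.cos φ
        - (y.1 * Real.cos φ - y.2 * Real.sin φ) * Real.sin φ = y.2 := by
      linear_combination y.2 * hcs
    rw [e1, e2]
    exact ⟨⟨h1, h2⟩, h3, h4⟩
  · intro hz
    refine ⟨((z.1 - p.1) * Real.cos φ + (z.2 - p.2) * Real.sin φ,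
      (z.2 - p.2) * Real.cos φ - (z.1 - p.1) * Real.sin φ), hz, ?_⟩
    ext
    · simp only [rot, Prod.fst_add]
      linear_combination (z.1 - p.1) * hcs
    · simp only [rot, Prod.snd_add]
      linear_combination (z.2 - p.2) * hcs

lemma volume_rect {φ w h : ℝ} (p : ℝ × ℝ) (hw : 0 ≤ w) (hh : 0 ≤ h) :
    (volume (rect φ p w h)).toReal = w * h := by
  set M : Matrix (Fin 2) (Fin 2) ℝ := !![Real.cos φ, -Real.sin φ; Real.sin φ, Real.cos φ] with hM
  set f := Matrix.toLin (Module.Basis.finTwoProd ℝ) (Module.Basis.finTwoProd ℝ) M with hf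
  have hrot : ∀ x, f x = rot φ x := by
    intro x
    rw [hf, hM, Matrix.toLin_finTwoProd_apply]
    simp only [rot]
    ext <;> simp <;> ring
  have hdet : LinearMap.det f = 1 := by
    rw [hf, LinearMap.det_toLin, hM, Matrix.det_fin_two_of]
    linarith [Real.sin_sq_add_cos_sq φ]
  have himg : rect φ p w h = (fun x => p + x) '' (f '' (Set.Icc 0 w ×ˢ Set.Icc 0 h)) := by
    rw [Set.image_image]
    simp only [hrot, rect]
  rw [himg, Set.image_add_left, measure_preimage_add, Measure.addHaar_image_linearMap, hdet,
    Measure.volume_eq_prod, Measure.prod_prod, Real.volume_Icc, Real.volume_Icc]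
  simp [ENNReal.toReal_ofReal, hw, hh]

lemma unitSq_eq_rect : unitSq = rect 0 (0, 0) 1 1 := by
  ext z
  rw [mem_rect]
  simp [unitSq, Prod.le_def]
  tauto

lemma ncard_inter_of_subset {X : Type*} {A B : Finset X} (hAB : A ⊆ B) (R : Set X) :
    |(((B : Set X) ∩ R).ncard : ℝ) - ((A : Set X) ∩ R).ncard| ≤ (B.card : ℝ) - A.card := by
  classical
  have h1 : ((A : Set X) ∩ R).ncard ≤ ((B : Set X) ∩ R).ncard :=
    Set.ncard_le_ncard (Set.inter_subset_inter_left _ (Finset.coe_subset.2 hAB))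
      (B.finite_toSet.inter_of_left R)
  have h2 : ((B : Set X) ∩ R).ncard ≤ ((A : Set X) ∩ R).ncard + (B \ A).card := by
    rw [← Set.ncard_coe_finset (B \ A)]
    refine (Set.ncard_le_ncard ?_ ((A.finite_toSet.inter_of_left R).union
      (B \ A).finite_toSet)).trans (Set.ncard_union_le _ _)
    rintro x ⟨hxB, hxR⟩
    by_cases hxA : x ∈ A
    · exact Or.inl ⟨hxA, hxR⟩
    · exact Or.inr (by simpa using ⟨hxB, hxA⟩)
  rw [Finset.card_sdiff_of_subset hAB] at h2
  have h3 := Finset.card_le_card hAB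
  have h1' : (((A : Set X) ∩ R).ncard : ℝ) ≤ ((B : Set X) ∩ R).ncard := by exact_mod_cast h1
  have h2' : (((B : Set X) ∩ R).ncard : ℝ) ≤ ((A : Set X) ∩ R).ncard + (B.card - A.card) := by
    rw [← Nat.cast_sub h3]
    exact_mod_cast h2
  rw [abs_of_nonneg (by linarith)]
  linarith

lemma exists_finset_card_eq_near {X : Type*} {Q : Set X} (hQ : Q.Infinite) {A : Finset X}
    (hA : (A : Set X) ⊆ Q) {N : ℕ} (hN : 0 < N) :
    ∃ P : Finset X, P.card = N ∧ (P : Set X) ⊆ Q ∧ ∀ R : Set X,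
      |(((P : Set X) ∩ R).ncard : ℝ) - ((A : Set X) ∩ R).ncard| ≤ |(A.card : ℝ) - N| := by
  rcases le_total A.card N with h | h
  · obtain ⟨P', hAP, hPQ, hP⟩ := hQ.exists_superset_ncard_eq hA A.finite_toSet
      (k := N) (by simpa using h)
    have hfin : P'.Finite := Set.finite_of_ncard_pos (by omega)
    lift P' to Finset X using hfin
    rw [Set.ncard_coe_finset] at hP
    refine ⟨P', hP, hPQ, fun R => (ncard_inter_of_subset (Finset.coe_subset.1 hAP) R).trans ?_⟩
    rw [hP, abs_sub_comm]
    exact le_abs_self _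
  · obtain ⟨P, hPA, hP⟩ := Finset.exists_subset_card_eq h
    refine ⟨P, hP, (Finset.coe_subset.2 hPA).trans hA, fun R => ?_⟩
    rw [abs_sub_comm]
    refine (ncard_inter_of_subset hPA R).trans ?_
    rw [hP]
    exact le_abs_self _

/-- Rotated lattice points of density `N` are well distributed in rectangles of all directions
from which the lattice direction stays Diophantine. -/
lemma exists_points_discrepancy {Ω : Set ℝ} (hΩ : Ω ⊆ Set.Ioo 0 (Real.pi / 2)) {c σ α : ℝ}
    (hc : 0 < c) (hc1 : c ≤ 1) (hσ : 0 < σ) (hα : α ∈ Set.Icc (0 : ℝ) 1)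
    (hbad : ∀ θ, (θ ∈ Ω ∨ θ = 0) → AngleBad c σ (θ - α)) :
    ∃ K : ℝ, 0 < K ∧ ∀ N : ℕ, 2 ≤ N → ∃ P : Finset (ℝ × ℝ), P.card = N ∧
      (P : Set (ℝ × ℝ)) ⊆ unitSq ∧ ∀ t ∈ paramSet Ω,
        |(((P : Set (ℝ × ℝ)) ∩ rect t.1 t.2.1 t.2.2.1 t.2.2.2).ncard : ℝ)
          - (N : ℝ) * (volume (rect t.1 t.2.1 t.2.2.1 t.2.2.2)).toReal|
          ≤ K * (N : ℝ) ^ (σ / (1 + σ) / 2) := by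
  obtain ⟨K, hK, hcount⟩ := exists_lattice_count_of_angleBad hc hc1 hσ
  refine ⟨2 * K, by positivity, fun N hN => ?_⟩
  have hN1 : (1 : ℝ) ≤ N := by exact_mod_cast (by omega : 1 ≤ N)
  set ρ := Real.sqrt N with hρ
  have hρ1 : 1 ≤ ρ := Real.one_le_sqrt.2 hN1
  have hρ0 : 0 < ρ := by linarith
  have hρ2 : ρ * ρ = N := Real.mul_self_sqrt (by linarith)
  have hρa : ρ ^ (σ / (1 + σ)) = (N : ℝ) ^ (σ / (1 + σ) / 2) := by
    rw [hρ, Real.sqrt_eq_rpow, ← Real.rpow_mul (by linarith)]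
    congr 1
    ring
  have hcsα := Real.sin_sq_add_cos_sq α
  let emb : ℤ × ℤ ↪ ℝ × ℝ :=
    ⟨fun z => ((z.1 * Real.cos α - z.2 * Real.sin α) / ρ,
      (z.1 * Real.sin α + z.2 * Real.cos α) / ρ), by
      rintro ⟨i, j⟩ ⟨i', j'⟩ h
      simp only [Prod.mk.injEq, div_left_inj' hρ0.ne'] at h
      obtain ⟨h1, h2⟩ := h
      have hi : (i : ℝ) = i' := by
        linear_combination (-i + i' : ℝ) * hcsα + Real.cos α * h1 + Real.sin α * h2
      have hj : (j : ℝ) = j' := by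
        linear_combination (-j + j' : ℝ) * hcsα - Real.sin α * h1 + Real.cos α * h2
      simp only [Prod.mk.injEq]
      exact ⟨by exact_mod_cast hi, by exact_mod_cast hj⟩⟩
  have hemb₁ : ∀ z, (emb z).1 = (z.1 * Real.cos α - z.2 * Real.sin α) / ρ := fun _ => rfl
  have hemb₂ : ∀ z, (emb z).2 = (z.1 * Real.sin α + z.2 * Real.cos α) / ρ := fun _ => rfl
  have hrect : ∀ (φ : ℝ) (p : ℝ × ℝ) (w h : ℝ), (φ ∈ Ω ∨ φ = 0) → 0 ≤ w → w ≤ 1 → 0 ≤ h →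
      h ≤ 1 → ∃ S : Finset (ℤ × ℤ), (∀ z, z ∈ S ↔ emb z ∈ rect φ p w h) ∧
        |(S.card : ℝ) - N * (w * h)| ≤ K * (N : ℝ) ^ (σ / (1 + σ) / 2) := by
    intro φ p w h hφ hw hw1 hh hh1
    have hφ' : 0 ≤ φ ∧ φ ≤ Real.pi / 2 := by
      rcases hφ with h | rfl
      · exact ⟨(hΩ h).1.le, (hΩ h).2.le⟩
      · exact ⟨le_rfl, by positivity⟩
    have hcos : 0 ≤ Real.cos (φ - α) := by
      apply Real.cos_nonneg_of_neg_pi_div_two_le_of_le <;>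
        linarith [hφ'.1, hφ'.2, hα.1, hα.2, Real.pi_gt_three]
    obtain ⟨S, hS, hcard⟩ := hcount (φ - α) (hbad φ hφ) hcos ρ (ρ * w) (ρ * h) hρ1
      (by positivity) (by nlinarith) (by positivity) (by nlinarith)
      (ρ * (p.1 * Real.cos φ + p.2 * Real.sin φ)) (ρ * (p.2 * Real.cos φ - p.1 * Real.sin φ))
    refine ⟨S, fun z => (hS z).trans ?_, ?_⟩
    · rw [mem_rect]
      have e1 : z.1 * Real.cos (φ - α) + z.2 * Real.sin (φ - α)
          = ρ * (((emb z).1 - p.1) * Real.cos φ + ((emb z).2 - p.2) * Real.sin φ)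
            + ρ * (p.1 * Real.cos φ + p.2 * Real.sin φ) := by
        rw [hemb₁, hemb₂, Real.cos_sub, Real.sin_sub]
        field_simp
        ring
      have e2 : z.2 * Real.cos (φ - α) - z.1 * Real.sin (φ - α)
          = ρ * (((emb z).2 - p.2) * Real.cos φ - ((emb z).1 - p.1) * Real.sin φ)
            + ρ * (p.2 * Real.cos φ - p.1 * Real.sin φ) := by
        rw [hemb₁, hemb₂, Real.cos_sub, Real.sin_sub]
        field_simp
        ring
      rw [e1, e2, le_add_iff_nonneg_left, le_add_iff_nonneg_left, add_comm (ρ * _) (ρ * w),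
        add_comm (ρ * _) (ρ * h), add_le_add_iff_right, add_le_add_iff_right,
        mul_nonneg_iff_of_pos_left hρ0, mul_nonneg_iff_of_pos_left hρ0,
        mul_le_mul_iff_of_pos_left hρ0, mul_le_mul_iff_of_pos_left hρ0]
    · rw [hρa] at hcard
      rwa [show ρ * w * (ρ * h) = N * (w * h) by rw [← hρ2]; ring] at hcard
  obtain ⟨S₀, hS₀, hcard₀⟩ := hrect 0 (0, 0) 1 1 (Or.inr rfl) zero_le_one le_rfl zero_le_one le_rfl
  rw [mul_one, mul_one] at hcard₀
  have hsub₀ : ((S₀.map emb : Finset (ℝ × ℝ)) : Set (ℝ × ℝ)) ⊆ unitSq := by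
    intro y hy
    obtain ⟨z, hz, rfl⟩ := Finset.mem_map.1 (Finset.mem_coe.1 hy)
    rw [unitSq_eq_rect]
    exact (hS₀ z).1 hz
  have hinf : unitSq.Infinite :=
    Set.Infinite.prod_left (Set.Icc_infinite one_pos) ⟨0, by simp⟩
  obtain ⟨P, hPN, hPsub, hP⟩ := exists_finset_card_eq_near hinf hsub₀ (by omega : 0 < N)
  refine ⟨P, hPN, hPsub, ?_⟩
  rintro ⟨φ, p, w, h⟩ ⟨-, hφ, -, hw, hh, hR⟩
  dsimp only at hφ hw hh hR ⊢
  obtain ⟨S, hS, hcard⟩ := hrect φ p w h hφ hw.1.le hw.2 hh.1.le hh.2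
  have hinter : ((S₀.map emb : Finset (ℝ × ℝ)) : Set (ℝ × ℝ)) ∩ rect φ p w h
      = ((S.map emb : Finset (ℝ × ℝ)) : Set (ℝ × ℝ)) := by
    ext y
    constructor
    · rintro ⟨hy, hyR⟩
      obtain ⟨z, -, rfl⟩ := Finset.mem_map.1 (Finset.mem_coe.1 hy)
      exact Finset.mem_coe.2 (Finset.mem_map_of_mem _ ((hS z).2 hyR))
    · intro hy
      obtain ⟨z, hz, rfl⟩ := Finset.mem_map.1 (Finset.mem_coe.1 hy)
      have hzR := (hS z).1 hz
      refine ⟨Finset.mem_coe.2 (Finset.mem_map_of_mem _ ((hS₀ z).2 ?_)), hzR⟩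
      rw [← unitSq_eq_rect]
      exact hR hzR
  have hPR := hP (rect φ p w h)
  rw [hinter, Set.ncard_coe_finset, Finset.card_map, Finset.card_map] at hPR
  rw [volume_rect p hw.1.le hh.1.le]
  have := abs_sub_le (((P : Set (ℝ × ℝ)) ∩ rect φ p w h).ncard : ℝ) S.card (N * (w * h))
  linarith

/-- If `Ω ⊆ (0, π/2)` has upper Minkowski dimension at most `d < 1` and
`τ = 2/(1-d)² - 2 < 1`, then for every `ε > 0`, every `N ≥ 2` and every probability
measure `μ` on the parameter space of rectangles pointing in the directions of
`Ω ∪ {0}` and contained in `[0,1]²`, there is an `N`-point set `P ⊆ [0,1]²` whose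
`L²(μ)`-discrepancy is at most `C N^{τ/(2(τ+1)) + ε}`. -/
theorem L2_discrepancy_minkowski
    (d : ℝ) (hd0 : 0 ≤ d) (hd1 : d < 1) (Ω : Set ℝ)
    (hΩ : Ω ⊆ Set.Ioo 0 (Real.pi / 2)) (hmink : MinkowskiBound Ω d)
    (τ : ℝ) (hτ : τ = 2 / (1 - d) ^ 2 - 2) (hτ1 : τ < 1) (ε : ℝ) (hε : 0 < ε) :
    ∃ C : ℝ, 0 < C ∧ ∀ N : ℕ, 2 ≤ N →
      ∀ μ : Measure (paramSet Ω), IsProbabilityMeasure μ →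
        ∃ P : Finset (ℝ × ℝ), P.card = N ∧ (P : Set (ℝ × ℝ)) ⊆ unitSq ∧
          Real.sqrt (∫ t, (|(((P : Set (ℝ × ℝ)) ∩
                rect t.1.1 t.1.2.1 t.1.2.2.1 t.1.2.2.2).ncard : ℝ) -
              (N : ℝ) * (volume (rect t.1.1 t.1.2.1 t.1.2.2.1 t.1.2.2.2)).toReal|) ^ 2 ∂μ)
            ≤ C * (N : ℝ) ^ (τ / (2 * (τ + 1)) + ε) := by
  have h1d : 0 < 1 - d := by linarith
  have hτ2 : 2 ≤ (2 + τ) * (1 - d) := by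
    have : (2 + τ) * (1 - d) = 2 / (1 - d) := by rw [hτ]; field_simp; ring
    rw [this, le_div_iff₀ h1d]
    linarith
  have hτ0 : 0 ≤ τ := by
    by_contra! h
    nlinarith
  set σ := τ + ε with hσdef
  have hσ : 0 < σ := by linarith
  obtain ⟨c, hc, hc1, α, hα, hbad⟩ := exists_angleBad (σ := σ) hd0 hmink hσ (by nlinarith)
  obtain ⟨K, hK, hmain⟩ := exists_points_discrepancy hΩ hc hc1 hσ hα hbad
  refine ⟨K, hK, fun N hN μ hμ => ?_⟩
  obtain ⟨P, hPN, hPsub, hP⟩ := hmain N hN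
  refine ⟨P, hPN, hPsub, ?_⟩
  have hN1 : (1 : ℝ) ≤ N := by exact_mod_cast (by omega : 1 ≤ N)
  have hexp : σ / (1 + σ) / 2 ≤ τ / (2 * (τ + 1)) + ε := by
    have h1 : σ / (1 + σ) ≤ τ / (τ + 1) + ε := by
      have e : σ / (1 + σ) = τ / (1 + σ) + ε / (1 + σ) := by rw [hσdef]; ring
      have h2 : τ / (1 + σ) ≤ τ / (τ + 1) := 
        div_le_div_of_nonneg_left hτ0 (by linarith) (by linarith)
      have h3 : ε / (1 + σ) ≤ ε := div_le_self hε.le (by linarith)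
      linarith
    have e : τ / (2 * (τ + 1)) = τ / (τ + 1) / 2 := by field_simp
    rw [e]
    linarith
  set b := K * (N : ℝ) ^ (σ / (1 + σ) / 2) with hb
  have hb0 : 0 ≤ b := by positivity
  have hbC : b ≤ K * (N : ℝ) ^ (τ / (2 * (τ + 1)) + ε) := by
    rw [hb]
    gcongr
  refine le_trans (Real.sqrt_le_iff.2 ⟨hb0, ?_⟩) hbC
  calc _ ≤ ∫ _t, b ^ 2 ∂μ := by
        refine integral_mono_of_nonneg (Filter.Eventually.of_forall fun t => by positivity)
          (integrable_const _) (Filter.Eventually.of_forall fun t => ?_)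
        exact pow_le_pow_left₀ (abs_nonneg _) (hP t.1 t.2) 2
    _ = b ^ 2 := by simp

end
end

section
/- There exist constants c > 0, δ > 0, a natural number n₀, and a sequence of nested closed intervals I_{n₀} ⊇ I_{n₀+1} ⊇ ... ⊇ I_n ⊇ ... contained in [0, π/2], with |I_n| = δ·(n+2)^{−(n+2)}·(log(n+2))^{−(n+2)}, such that for every n ≥ n₀, every α ∈ I_n, every positive integer k, every integer p, and every integer q with n^{n/2}(log n)^{n/2} ≤ q < (n+1)^{(n+1)/2}(log(n+1))^{(n+1)/2}, one has |tan(α − 2^{−k}) − p/q| > c(n)/q², where c(n) = c / ((n+1)² (log(n+1))²). -/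
noncomputable section

/-- `plog n = max {1, log₂ n}`. -/
def plog (n : ℕ) : ℝ := max 1 (Real.logb 2 n)

/-- `R(n) = n^{n/2} (log n)^{n/2}`. -/
def Rfn (n : ℕ) : ℝ := (n : ℝ) ^ ((n : ℝ) / 2) * (plog n) ^ ((n : ℝ) / 2)

/-- The prescribed length of the interval `I_n`:
`|I_n| = δ (n+2)^{-(n+2)} (log(n+2))^{-(n+2)}`. -/
def len (δ : ℝ) (n : ℕ) : ℝ :=
  δ * ((n : ℝ) + 2) ^ (-((n : ℝ) + 2)) * (plog (n + 2)) ^ (-((n : ℝ) + 2))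

/-- Finitely many sets of total size less than `L - L'`, after enlarging each by `L'`, miss a
subinterval of length `L'` of any interval of length `L`. -/
theorem exists_Icc_disjoint_of_sum_lt {ι : Type*} (F : Finset ι) (B : ι → Set ℝ) (d : ι → ℝ)
    {x L L' : ℝ} (hL' : 0 ≤ L') (hd : ∀ i ∈ F, ∀ s ∈ B i, ∀ t ∈ B i, |s - t| ≤ d i)
    (hd0 : ∀ i ∈ F, 0 ≤ d i) (hsum : ∑ i ∈ F, (d i + L') < L - L') :
    ∃ y, x ≤ y ∧ y + L' ≤ x + L ∧ ∀ s ∈ Set.Icc y (y + L'), ∀ i ∈ F, s ∉ B i := by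
  set E : ι → Set ℝ := fun i => {y | ∃ s ∈ Set.Icc y (y + L'), s ∈ B i}
  have hvol : ∀ i ∈ F, MeasureTheory.volume (E i) ≤ ENNReal.ofReal (d i + L') := by
    intro i hi
    refine (Real.volume_le_diam _).trans ?_
    refine Metric.ediam_le fun y₁ h₁ y₂ h₂ => ?_
    obtain ⟨s₁, hs₁, hb₁⟩ := h₁
    obtain ⟨s₂, hs₂, hb₂⟩ := h₂
    rw [edist_dist, Real.dist_eq]
    refine ENNReal.ofReal_le_ofReal ?_
    have h := abs_le.1 (hd i hi s₁ hb₁ s₂ hb₂)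
    rw [Set.mem_Icc] at hs₁ hs₂
    rw [abs_le]
    constructor <;> linarith
  by_contra! hcon
  have hsub : Set.Icc x (x + (L - L')) ⊆ ⋃ i ∈ F, E i := by
    intro y hy
    obtain ⟨s, hs, i, hi, hb⟩ := hcon y hy.1 (by linarith [hy.2])
    exact Set.mem_biUnion hi ⟨s, hs, hb⟩
  have h1 : MeasureTheory.volume (Set.Icc x (x + (L - L'))) ≤
      ENNReal.ofReal (∑ i ∈ F, (d i + L')) := by
    rw [ENNReal.ofReal_sum_of_nonneg fun i hi => add_nonneg (hd0 i hi) hL']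
    exact (MeasureTheory.measure_mono hsub).trans
      ((MeasureTheory.measure_biUnion_finset_le F E).trans (Finset.sum_le_sum hvol))
  rw [Real.volume_Icc, add_sub_cancel_left] at h1
  have h0 : 0 ≤ ∑ i ∈ F, (d i + L') :=
    Finset.sum_nonneg fun i hi => add_nonneg (hd0 i hi) hL'
  exact absurd ((ENNReal.ofReal_le_ofReal_iff h0).1 h1) (not_le.2 hsum)

theorem half_le_cos {u : ℝ} (hu : |u| ≤ 1) : 1 / 2 ≤ Real.cos u := by
  rw [← Real.cos_abs, ← Real.cos_pi_div_three]
  have := Real.pi_gt_three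
  exact Real.cos_le_cos_of_nonneg_of_le_pi (abs_nonneg u) (by linarith) (by linarith)

theorem abs_tan_sub_tan_le {u v : ℝ} (hu : |u| ≤ 1) (hv : |v| ≤ 1) :
    |Real.tan u - Real.tan v| ≤ 4 * |u - v| := by
  have hcu := half_le_cos hu
  have hcv := half_le_cos hv
  have h : Real.tan u - Real.tan v = Real.sin (u - v) / (Real.cos u * Real.cos v) := by
    rw [Real.tan_eq_sin_div_cos, Real.tan_eq_sin_div_cos, Real.sin_sub]
    field_simp
  have hc : 1 / 4 ≤ Real.cos u * Real.cos v := by nlinarith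
  rw [h, abs_div, abs_of_pos (by linarith : 0 < Real.cos u * Real.cos v),
    div_le_iff₀ (by linarith)]
  have := Real.abs_sin_le_abs (x := u - v)
  nlinarith [abs_nonneg (u - v)]

theorem abs_sub_le_abs_tan_sub_tan {u v : ℝ} (hu : |u| ≤ 1) (hv : |v| ≤ 1) :
    |u - v| ≤ |Real.tan u - Real.tan v| := by
  wlog huv : v ≤ u generalizing u v
  · rw [abs_sub_comm u, abs_sub_comm (Real.tan u)]
    exact this hv hu (le_of_not_ge huv)
  have hcos : ∀ w ∈ Set.Icc (-1 : ℝ) 1, 0 < Real.cos w := fun w hw => by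
    linarith [half_le_cos (abs_le.2 hw)]
  have h := (convex_Icc (-1 : ℝ) 1).mul_sub_le_image_sub_of_le_deriv (f := Real.tan) (C := 1)
    (fun w hw => (Real.continuousAt_tan.2 (hcos w hw).ne').continuousWithinAt)
    (fun w hw => (Real.differentiableAt_tan.2
      (hcos w (interior_subset hw)).ne').differentiableWithinAt)
    (fun w hw => by
      have hw' := hcos w (interior_subset hw)
      rw [Real.deriv_tan, le_div_iff₀ (by positivity), one_mul]
      exact pow_le_one₀ hw'.le (Real.cos_le_one w))
    v (abs_le.1 hv) u (abs_le.1 hu) huv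
  rw [abs_of_nonneg (sub_nonneg.2 huv)]
  exact (one_mul (u - v) ▸ h).trans (le_abs_self _)

/-- Fractions with denominators at most `M` that are closer than `1 / M ^ 2` are equal. -/
theorem div_eq_div_of_abs_sub_lt {p₁ p₂ : ℤ} {q₁ q₂ : ℕ} {M : ℝ} (h₁ : 0 < (q₁ : ℝ))
    (h₂ : 0 < (q₂ : ℝ)) (hM₁ : (q₁ : ℝ) ≤ M) (hM₂ : (q₂ : ℝ) ≤ M)
    (h : |(p₁ : ℝ) / q₁ - p₂ / q₂| < 1 / M ^ 2) : (p₁ : ℝ) / q₁ = p₂ / q₂ := by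
  have hM : 0 < M := h₁.trans_le hM₁
  rw [div_sub_div _ _ h₁.ne' h₂.ne', abs_div, abs_of_pos (mul_pos h₁ h₂),
    div_lt_div_iff₀ (mul_pos h₁ h₂) (by positivity)] at h
  have hq : (q₁ : ℝ) * q₂ ≤ M ^ 2 := by nlinarith
  have hlt : |(p₁ : ℝ) * q₂ - q₁ * p₂| < 1 := by
    by_contra! hge
    nlinarith [mul_le_mul_of_nonneg_right hge (sq_nonneg M)]
  have hz : |p₁ * q₂ - q₁ * p₂| < 1 := by exact_mod_cast hlt
  rw [Int.abs_lt_one_iff, sub_eq_zero] at hz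
  rw [div_eq_div_iff h₁.ne' h₂.ne', mul_comm (p₂ : ℝ)]
  exact_mod_cast hz

/-- `n log n`, whose `n`-th power is the square of `Rfn n`. -/
def nlogn (n : ℕ) : ℝ := (n : ℝ) * plog n

theorem one_le_plog (n : ℕ) : 1 ≤ plog n := le_max_left _ _

theorem one_le_nlogn {n : ℕ} (hn : 1 ≤ n) : 1 ≤ nlogn n := by
  have h : (1 : ℝ) ≤ n := by exact_mod_cast hn
  exact one_le_mul_of_one_le_of_one_le h (one_le_plog n)

theorem Rfn_sq (n : ℕ) : Rfn n ^ 2 = nlogn n ^ n := by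
  have h : ∀ x : ℝ, 0 ≤ x → (x ^ ((n : ℝ) / 2)) ^ 2 = x ^ n := fun x hx => by
    rw [← Real.rpow_natCast, ← Real.rpow_mul hx]
    push_cast
    rw [div_mul_cancel₀ _ two_ne_zero, Real.rpow_natCast]
  rw [Rfn, nlogn, mul_pow, mul_pow, h _ n.cast_nonneg, h _ (by linarith [one_le_plog n])]

theorem Rfn_nonneg (n : ℕ) : 0 ≤ Rfn n := by
  have := one_le_plog n
  unfold Rfn
  positivity

theorem Rfn_pos {n : ℕ} (hn : 1 ≤ n) : 0 < Rfn n := by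
  refine (Rfn_nonneg n).lt_of_ne' fun h => ?_
  have h2 := Rfn_sq n
  rw [h] at h2
  have := one_le_pow₀ (n := n) (one_le_nlogn hn)
  norm_num at h2
  linarith

theorem len_eq (δ : ℝ) (n : ℕ) : len δ n = δ / nlogn (n + 2) ^ (n + 2) := by
  have hp := one_le_plog (n + 2)
  have hn : (n : ℝ) + 2 = ((n + 2 : ℕ) : ℝ) := by push_cast; ring
  rw [len, hn, Real.rpow_neg (by positivity), Real.rpow_neg (by positivity), Real.rpow_natCast,
    Real.rpow_natCast, nlogn, mul_pow]
  field_simp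

theorem plog_mono {m n : ℕ} (hm : 1 ≤ m) (h : m ≤ n) : plog m ≤ plog n := by
  have hm' : (0 : ℝ) < m := by exact_mod_cast hm
  exact max_le_max le_rfl
    (Real.logb_le_logb_of_le one_lt_two hm' (by exact_mod_cast h))

theorem nlogn_mono {m n : ℕ} (hm : 1 ≤ m) (h : m ≤ n) : nlogn m ≤ nlogn n :=
  mul_le_mul (by exact_mod_cast h) (plog_mono hm h) (by linarith [one_le_plog m]) n.cast_nonneg

theorem plog_succ_le {m : ℕ} (hm : 1 ≤ m) : plog (m + 1) ≤ (1 + 2 / m) * plog m := by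
  have hm' : (0 : ℝ) < m := by exact_mod_cast hm
  have h1 := one_le_plog m
  have h2 : 2 / (m : ℝ) ≤ 2 / m * plog m := le_mul_of_one_le_right (by positivity) h1
  refine max_le (by nlinarith [show 0 < 2 / (m : ℝ) by positivity]) ?_
  have h3 : ((m + 1 : ℕ) : ℝ) = m * (1 + 1 / m) := by push_cast; field_simp
  have h4 : Real.logb 2 (1 + 1 / m) ≤ 2 / m := by
    have hl := Real.log_two_gt_d9
    have hle := Real.log_le_sub_one_of_pos (show 0 < 1 + 1 / (m : ℝ) by positivity)
    rw [Real.logb, div_le_iff₀ (by linarith)]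
    have : 2 / (m : ℝ) * (1 / 2) ≤ 2 / m * Real.log 2 := by gcongr; linarith
    calc _ ≤ _ := hle
      _ = 2 / (m : ℝ) * (1 / 2) := by ring
      _ ≤ _ := this
  rw [h3, Real.logb_mul hm'.ne' (by positivity)]
  have h5 : Real.logb 2 m ≤ plog m := le_max_right _ _
  linarith

theorem nlogn_succ_pow_le {m : ℕ} (hm : 1 ≤ m) :
    nlogn (m + 1) ^ (m + 1) ≤ Real.exp 3 * nlogn (m + 1) * nlogn m ^ m := by
  have hm' : (0 : ℝ) < m := by exact_mod_cast hm
  have h1 := one_le_plog m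
  have h0 := one_le_nlogn hm
  have h0' := one_le_nlogn (Nat.le_add_left 1 m)
  have hstep : nlogn (m + 1) ≤ Real.exp (3 / m) * nlogn m := by
    calc nlogn (m + 1) ≤ (m * (1 + 1 / m)) * ((1 + 2 / m) * plog m) := by
          rw [nlogn, show ((m + 1 : ℕ) : ℝ) = m * (1 + 1 / m) by push_cast; field_simp]
          gcongr
          exact plog_succ_le hm
      _ = (1 / m + 1) * (2 / m + 1) * nlogn m := by rw [nlogn]; ring
      _ ≤ Real.exp (1 / m) * Real.exp (2 / m) * nlogn m := by
          gcongr <;> exact Real.add_one_le_exp _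
      _ = Real.exp (3 / m) * nlogn m := by rw [← Real.exp_add]; ring_nf
  calc nlogn (m + 1) ^ (m + 1) = nlogn (m + 1) * nlogn (m + 1) ^ m := by ring
    _ ≤ nlogn (m + 1) * (Real.exp (3 / m) * nlogn m) ^ m := by gcongr
    _ = Real.exp 3 * nlogn (m + 1) * nlogn m ^ m := by
      rw [mul_pow, ← Real.exp_nat_mul, mul_div_cancel₀ _ hm'.ne']; ring

theorem le_nlogn_succ_pow {t : ℕ} (ht : 1 ≤ t) :
    2 * nlogn t * nlogn t ^ t ≤ nlogn (t + 1) ^ (t + 1) := by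
  have ht' : (0 : ℝ) < t := by exact_mod_cast ht
  have h0 := one_le_nlogn ht
  have hp := one_le_plog t
  have hstep : (1 + 1 / t) * nlogn t ≤ nlogn (t + 1) := by
    calc (1 + 1 / t) * nlogn t = ((t + 1 : ℕ) : ℝ) * plog t := by
          rw [nlogn]; push_cast; field_simp
      _ ≤ nlogn (t + 1) := by
          rw [nlogn]; gcongr; exact plog_mono ht (Nat.le_succ t)
  have hb : (2 : ℝ) ≤ (1 + 1 / t) ^ t := by
    have := one_add_mul_le_pow (a := 1 / (t : ℝ))
      (by linarith [show 0 < 1 / (t : ℝ) by positivity]) t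
    rw [mul_one_div_cancel ht'.ne'] at this
    linarith
  have h1 := one_le_nlogn (Nat.le_add_left 1 t)
  have hmono : nlogn t ≤ nlogn (t + 1) := nlogn_mono ht (Nat.le_succ t)
  calc 2 * nlogn t * nlogn t ^ t ≤ (1 + 1 / t) ^ t * nlogn t * nlogn t ^ t := by gcongr
    _ = nlogn t * ((1 + 1 / t) * nlogn t) ^ t := by rw [mul_pow]; ring
    _ ≤ nlogn (t + 1) * nlogn (t + 1) ^ t := by gcongr
    _ = _ := by ring

theorem eventually_logb_le :
    ∀ᶠ t : ℕ in Filter.atTop,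
      Real.logb 2 (64 * nlogn t ^ t) + 3 ≤ 3 / 2 * nlogn t := by
  have hplog : Filter.Tendsto plog Filter.atTop Filter.atTop :=
    Filter.tendsto_atTop_mono (fun _ => le_max_right _ _)
      ((Real.tendsto_logb_atTop one_lt_two).comp tendsto_natCast_atTop_atTop)
  have hlog : ∀ᶠ y : ℝ in Filter.atTop, Real.logb 2 y ≤ y / 4 := by
    have hl := Real.log_pos one_lt_two
    filter_upwards [Real.isLittleO_log_id_atTop.bound (show 0 < Real.log 2 / 4 by positivity),
      Filter.eventually_ge_atTop 1] with y hy hy1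
    rw [id, Real.norm_eq_abs, Real.norm_eq_abs, abs_of_nonneg (by linarith : 0 ≤ y)] at hy
    rw [Real.logb, div_le_iff₀ hl]
    linarith [le_abs_self (Real.log y)]
  filter_upwards [hplog.eventually hlog, Filter.eventually_ge_atTop 36] with t ht ht36
  have ht36' : (36 : ℝ) ≤ t := by exact_mod_cast ht36
  have hp := one_le_plog t
  have h0 := one_le_nlogn (by omega : 1 ≤ t)
  have h64 : Real.logb 2 64 = 6 := by
    rw [show (64 : ℝ) = 2 ^ (6 : ℝ) by norm_num, Real.logb_rpow two_pos (by norm_num)]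
  have hle : Real.logb 2 t ≤ plog t := le_max_right _ _
  rw [Real.logb_mul (by norm_num) (by positivity), h64, Real.logb_pow, nlogn,
    Real.logb_mul (by positivity) (by positivity)]
  have : (t : ℝ) * (Real.logb 2 t + Real.logb 2 (plog t)) ≤ t * (plog t + plog t / 4) := by
    gcongr
  nlinarith

/-- The points `α` such that some `p / q` with `Rfn m ≤ q < Rfn (m + 1)` lies within
`c / (nlogn (m + 1) ^ 2 q ^ 2)` of `tan (α - 2 ^ (-k))`. -/
def badSet (c : ℝ) (m k : ℕ) : Set ℝ :=
  {α | ∃ (p : ℤ) (q : ℕ), Rfn m ≤ (q : ℝ) ∧ (q : ℝ) < Rfn (m + 1) ∧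
    |Real.tan (α - 2 ^ (-(k : ℝ))) - (p : ℝ) / (q : ℝ)| ≤
      (c / (((m : ℝ) + 1) ^ 2 * (plog (m + 1)) ^ 2)) / (q : ℝ) ^ 2}

theorem approx_radius_le {m q : ℕ} (hm : 1 ≤ m) (hq : Rfn m ≤ (q : ℝ)) :
    (1 / (1600 * Real.exp 3) / (((m : ℝ) + 1) ^ 2 * (plog (m + 1)) ^ 2)) / (q : ℝ) ^ 2 ≤
      1 / (1600 * nlogn (m + 1) * nlogn (m + 1) ^ (m + 1)) := by
  have hR := Rfn_pos hm
  have hq0 : 0 < (q : ℝ) := hR.trans_le hq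
  have hT := one_le_nlogn (Nat.le_add_left 1 m)
  have hS : nlogn m ^ m ≤ (q : ℝ) ^ 2 := by
    rw [← Rfn_sq]
    gcongr
  have hrat := nlogn_succ_pow_le hm
  rw [← mul_pow, show ((m : ℝ) + 1) * plog (m + 1) = nlogn (m + 1) by rw [nlogn]; push_cast; rfl,
    div_div, div_div]
  refine one_div_le_one_div_of_le (by positivity) ?_
  calc 1600 * nlogn (m + 1) * nlogn (m + 1) ^ (m + 1)
      ≤ 1600 * nlogn (m + 1) * (Real.exp 3 * nlogn (m + 1) * nlogn m ^ m) := by gcongr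
    _ ≤ 1600 * nlogn (m + 1) * (Real.exp 3 * nlogn (m + 1) * (q : ℝ) ^ 2) := by gcongr
    _ = _ := by ring

theorem abs_sub_le_of_mem_badSet {m k₁ k₂ : ℕ} (hm : 1 ≤ m) {x L η s₁ s₂ : ℝ}
    (hL : L = 1 / 8 / nlogn (m + 1) ^ (m + 1)) (hx : 0 ≤ x) (hx1 : x + L ≤ 1)
    (hs₁ : s₁ ∈ Set.Icc x (x + L)) (hs₂ : s₂ ∈ Set.Icc x (x + L))
    (hb₁ : s₁ ∈ badSet (1 / (1600 * Real.exp 3)) m k₁)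
    (hb₂ : s₂ ∈ badSet (1 / (1600 * Real.exp 3)) m k₂)
    (hη : |(2 : ℝ) ^ (-(k₁ : ℝ)) - 2 ^ (-(k₂ : ℝ))| ≤ η) (hηL : η ≤ L / 8) :
    |s₁ - s₂| ≤ 2 * (L / (200 * nlogn (m + 1))) + η := by
  obtain ⟨p₁, q₁, hq₁, hq₁', h₁⟩ := hb₁
  obtain ⟨p₂, q₂, hq₂, hq₂', h₂⟩ := hb₂
  have hT := one_le_nlogn (Nat.le_add_left 1 m)
  have hpow : 0 < nlogn (m + 1) ^ (m + 1) := by positivity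
  have hL0 : 0 < L := by rw [hL]; positivity
  have hρ : 1 / (1600 * nlogn (m + 1) * nlogn (m + 1) ^ (m + 1)) = L / (200 * nlogn (m + 1)) := by
    rw [hL]; field_simp; norm_num
  have hρL : L / (200 * nlogn (m + 1)) ≤ L / 200 := by
    gcongr
    linarith
  have h₁' := h₁.trans ((approx_radius_le hm hq₁).trans_eq hρ)
  have h₂' := h₂.trans ((approx_radius_le hm hq₂).trans_eq hρ)
  set ρ := L / (200 * nlogn (m + 1))
  have hdom : ∀ (k : ℕ) (s : ℝ), s ∈ Set.Icc x (x + L) → |s - 2 ^ (-(k : ℝ))| ≤ 1 := by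
    intro k s hs
    have hpos : (0 : ℝ) < 2 ^ (-(k : ℝ)) := by positivity
    have hle : (2 : ℝ) ^ (-(k : ℝ)) ≤ 1 :=
      Real.rpow_le_one_of_one_le_of_nonpos one_le_two (by simp)
    rw [Set.mem_Icc] at hs
    rw [abs_le]
    constructor <;> linarith
  have hd₁ := hdom k₁ s₁ hs₁
  have hd₂ := hdom k₂ s₂ hs₂
  set e₁ : ℝ := 2 ^ (-(k₁ : ℝ))
  set e₂ : ℝ := 2 ^ (-(k₂ : ℝ))
  have hlip := abs_tan_sub_tan_le hd₁ hd₂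
  have hexp := abs_sub_le_abs_tan_sub_tan hd₁ hd₂
  rw [Set.mem_Icc] at hs₁ hs₂
  have huv : |(s₁ - e₁) - (s₂ - e₂)| ≤ L + L / 8 := by
    rw [abs_le] at hη ⊢
    constructor <;> linarith
  have hclose : |(p₁ : ℝ) / q₁ - p₂ / q₂| ≤ 2 * ρ + 4 * (L + L / 8) := by
    have h3 := abs_le.1 (hlip.trans (mul_le_mul_of_nonneg_left huv (by norm_num)))
    rw [abs_le] at h₁' h₂' ⊢
    constructor <;> linarith
  have hsep : 2 * ρ + 4 * (L + L / 8) < 1 / Rfn (m + 1) ^ 2 := by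
    have : 1 / Rfn (m + 1) ^ 2 = 8 * L := by rw [Rfn_sq, hL]; ring
    rw [this]
    linarith
  have hR := Rfn_pos hm
  have heq := div_eq_div_of_abs_sub_lt (hR.trans_le hq₁) (hR.trans_le hq₂) hq₁'.le hq₂'.le
    (hclose.trans_lt hsep)
  have htan : |Real.tan (s₁ - e₁) - Real.tan (s₂ - e₂)| ≤ 2 * ρ := by
    rw [heq] at h₁'
    rw [abs_le] at h₁' h₂' ⊢
    constructor <;> linarith
  have h4 := abs_le.1 (hexp.trans htan)
  rw [abs_le] at hη ⊢
  constructor <;> linarith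

theorem exists_subinterval_avoiding_badSet {m : ℕ} (hm : 1 ≤ m)
    (hlarge : Real.logb 2 (64 * nlogn (m + 1) ^ (m + 1)) + 3 ≤ 3 / 2 * nlogn (m + 1))
    {x L L' : ℝ} (hL : L = 1 / 8 / nlogn (m + 1) ^ (m + 1))
    (hL' : L' = 1 / 8 / nlogn (m + 2) ^ (m + 2)) (hx : 0 ≤ x) (hx1 : x + L ≤ 1) :
    ∃ y, x ≤ y ∧ y + L' ≤ x + L ∧
      ∀ s ∈ Set.Icc y (y + L'), ∀ k, s ∉ badSet (1 / (1600 * Real.exp 3)) m k := by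
  have hT := one_le_nlogn (Nat.le_add_left 1 m)
  have hT' := one_le_nlogn (Nat.le_add_left 1 (m + 1))
  have hpow : 0 < nlogn (m + 1) ^ (m + 1) := by positivity
  have hL0 : 0 < L := by rw [hL]; positivity
  have hL'0 : 0 < L' := by rw [hL']; positivity
  have hL'L : L' ≤ L / (2 * nlogn (m + 1)) := by
    rw [hL, hL', div_div (1 / 8 : ℝ)]
    refine div_le_div_of_nonneg_left (by norm_num) (by positivity) ?_
    rw [mul_comm]
    exact le_nlogn_succ_pow (Nat.le_add_left 1 m)
  set T := nlogn (m + 1)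
  set K : ℕ := ⌈Real.logb 2 (64 * T ^ (m + 1))⌉₊
  have hKle : (K : ℝ) + 2 ≤ 3 / 2 * T := by
    have h1 : (1 : ℝ) ≤ T ^ (m + 1) := one_le_pow₀ hT
    have := Nat.ceil_lt_add_one
      (Real.logb_nonneg (b := 2) one_lt_two (by linarith : 1 ≤ 64 * T ^ (m + 1)))
    linarith
  have hKL : (2 : ℝ) ^ (-(K : ℝ)) ≤ L / 8 := by
    have h1 : 64 * T ^ (m + 1) ≤ (2 : ℝ) ^ (K : ℝ) :=
      (Real.logb_le_iff_le_rpow one_lt_two (by positivity)).1 (Nat.le_ceil _)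
    rw [Real.rpow_neg two_pos.le, hL]
    calc ((2 : ℝ) ^ (K : ℝ))⁻¹ ≤ (64 * T ^ (m + 1))⁻¹ := inv_anti₀ (by positivity) h1
      _ = _ := by field_simp; norm_num
  set d : ℕ → ℝ := fun i => 2 * (L / (200 * T)) + if i = K then 2 ^ (-(K : ℝ)) else 0 with hd
  set B : ℕ → Set ℝ := fun i => {s | s ∈ Set.Icc x (x + L) ∧
    ∃ k, min k K = i ∧ s ∈ badSet (1 / (1600 * Real.exp 3)) m k}
  have hdiam : ∀ i ∈ Finset.range (K + 1), ∀ s ∈ B i, ∀ t ∈ B i, |s - t| ≤ d i := by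
    rintro i - s₁ ⟨hs₁, k₁, hk₁, hb₁⟩ s₂ ⟨hs₂, k₂, hk₂, hb₂⟩
    refine abs_sub_le_of_mem_badSet hm hL hx hx1 hs₁ hs₂ hb₁ hb₂ ?_ ?_
    · split_ifs with hi
      · have hle : ∀ k : ℕ, K ≤ k → (2 : ℝ) ^ (-(k : ℝ)) ≤ 2 ^ (-(K : ℝ)) := fun k hk =>
          Real.rpow_le_rpow_of_exponent_le one_le_two (neg_le_neg (by exact_mod_cast hk))
        have h₁ := hle k₁ (by omega)
        have h₂ := hle k₂ (by omega)
        have h₁' : (0 : ℝ) < 2 ^ (-(k₁ : ℝ)) := by positivity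
        have h₂' : (0 : ℝ) < 2 ^ (-(k₂ : ℝ)) := by positivity
        rw [abs_le]
        constructor <;> linarith
      · rw [show k₁ = k₂ by omega]
        simp
    · split_ifs
      · exact hKL
      · positivity
  have hnonneg : ∀ i ∈ Finset.range (K + 1), 0 ≤ d i := by
    intro i _
    simp only [hd]
    positivity
  have hlt : ∑ i ∈ Finset.range (K + 1), (d i + L') < L - L' := by
    have hsum : ∑ i ∈ Finset.range (K + 1), (d i + L') =
        (K + 1) * (2 * (L / (200 * T)) + L') + 2 ^ (-(K : ℝ)) := by
      simp only [hd, Finset.sum_add_distrib, Finset.sum_const, Finset.card_range, nsmul_eq_mul,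
        Finset.sum_ite_eq', Finset.mem_range, Nat.lt_succ_self, if_true]
      push_cast
      ring
    have h1 : ((K : ℝ) + 2) * (2 * (L / (200 * T)) + L') ≤
        3 / 2 * T * (2 * (L / (200 * T)) + L / (2 * T)) := by gcongr
    have h2 : 3 / 2 * T * (2 * (L / (200 * T)) + L / (2 * T)) = 153 / 200 * L := by
      field_simp
      norm_num
    have h3 : 0 < L / (200 * T) := by positivity
    rw [hsum]
    linarith
  obtain ⟨y, hxy, hyx, hy⟩ :=
    exists_Icc_disjoint_of_sum_lt (Finset.range (K + 1)) B d (x := x) hL'0.le hdiam hnonneg hlt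
  refine ⟨y, hxy, hyx, fun s hs k hk => ?_⟩
  exact hy s hs (min k K) (by simp) ⟨⟨hxy.trans hs.1, hs.2.trans hyx⟩, k, rfl, hk⟩

/-- The nested-interval construction for the lacunary sequence `{2^{-k}}`: there are
constants `c, δ > 0`, `n₀ ∈ ℕ`, and nested closed intervals
`I_n = [a n, a n + |I_n|] ⊆ [0, π/2]` of length `|I_n| = δ (n+2)^{-(n+2)} (log(n+2))^{-(n+2)}`
such that for all `n ≥ n₀`, all `α ∈ I_n`, all `k ≥ 1`, all integers `p` and all
integers `q` with `n^{n/2}(log n)^{n/2} ≤ q < (n+1)^{(n+1)/2}(log(n+1))^{(n+1)/2}`,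
one has `|tan(α - 2^{-k}) - p/q| > c(n)/q²` with `c(n) = c/((n+1)²(log(n+1))²)`. -/
theorem nested_intervals_lacunary :
    ∃ (c δ : ℝ) (n₀ : ℕ) (a : ℕ → ℝ), 0 < c ∧ 0 < δ ∧
      (∀ n : ℕ, n₀ ≤ n →
        Set.Icc (a (n + 1)) (a (n + 1) + len δ (n + 1)) ⊆
          Set.Icc (a n) (a n + len δ n)) ∧
      (∀ n : ℕ, n₀ ≤ n →
        Set.Icc (a n) (a n + len δ n) ⊆ Set.Icc 0 (Real.pi / 2)) ∧
      (∀ n : ℕ, n₀ ≤ n → ∀ α ∈ Set.Icc (a n) (a n + len δ n),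
        ∀ k : ℕ, 1 ≤ k → ∀ (p : ℤ) (q : ℕ),
          Rfn n ≤ (q : ℝ) → (q : ℝ) < Rfn (n + 1) →
          |Real.tan (α - 2 ^ (-(k : ℝ))) - (p : ℝ) / (q : ℝ)| >
            (c / (((n : ℝ) + 1) ^ 2 * (plog (n + 1)) ^ 2)) / (q : ℝ) ^ 2) := by
  obtain ⟨N, hN⟩ := Filter.eventually_atTop.1 eventually_logb_le
  have hlen : ∀ n, len (1 / 8) n ≤ 1 := fun n => by
    rw [len_eq]
    have h := one_le_pow₀ (n := n + 2) (one_le_nlogn (Nat.le_add_left 1 (n + 1)))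
    exact div_le_one_of_le₀ (by linarith) (by linarith)
  have step : ∀ n x, ∃ y, N ≤ n → 0 ≤ x → x + len (1 / 8) n ≤ 1 →
      x ≤ y ∧ y + len (1 / 8) (n + 1) ≤ x + len (1 / 8) n ∧
        ∀ s ∈ Set.Icc y (y + len (1 / 8) (n + 1)), ∀ k,
          s ∉ badSet (1 / (1600 * Real.exp 3)) (n + 1) k := by
    intro n x
    by_cases h : N ≤ n ∧ 0 ≤ x ∧ x + len (1 / 8) n ≤ 1
    · obtain ⟨y, hy⟩ := exists_subinterval_avoiding_badSet (Nat.le_add_left 1 n)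
        (hN (n + 1 + 1) (by omega)) (len_eq (1 / 8) n) (len_eq (1 / 8) (n + 1)) h.2.1 h.2.2
      exact ⟨y, fun _ _ _ => hy⟩
    · exact ⟨0, fun h₁ h₂ h₃ => absurd ⟨h₁, h₂, h₃⟩ h⟩
  choose f hf using step
  set b : ℕ → ℝ := fun j => Nat.rec 0 (fun i x => f (N + i) x) j with hb
  have hb_succ : ∀ j, b (j + 1) = f (N + j) (b j) := fun _ => rfl
  have hinv : ∀ j, 0 ≤ b j ∧ b j + len (1 / 8) (N + j) ≤ 1 := by
    intro j
    induction j with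
    | zero => exact ⟨le_rfl, by simpa [hb] using hlen N⟩
    | succ j ih =>
      have h := hf (N + j) (b j) (Nat.le_add_right N j) ih.1 ih.2
      rw [hb_succ]
      exact ⟨ih.1.trans h.1, h.2.1.trans ih.2⟩
  have hstep : ∀ j, _ := fun j => hf (N + j) (b j) (Nat.le_add_right N j) (hinv j).1 (hinv j).2
  refine ⟨1 / (1600 * Real.exp 3), 1 / 8, N + 1, fun n => b (n - N), by positivity, by norm_num,
    fun n hn => ?_, fun n hn => ?_, fun n hn α hα k _ p q hq hq' => ?_⟩
  · obtain ⟨j, rfl⟩ := Nat.exists_eq_add_of_le (Nat.le_of_succ_le hn)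
    simp only [add_assoc, Nat.add_sub_cancel_left]
    exact Set.Icc_subset_Icc (hstep j).1 (hstep j).2.1
  · obtain ⟨j, rfl⟩ := Nat.exists_eq_add_of_le (Nat.le_of_succ_le hn)
    simp only [Nat.add_sub_cancel_left]
    exact Set.Icc_subset_Icc (hinv j).1 (by linarith [(hinv j).2, Real.pi_gt_three])
  · obtain ⟨j, rfl⟩ := Nat.exists_eq_add_of_le hn
    have hj : N + 1 + j = N + (j + 1) := by ring
    simp only [hj, Nat.add_sub_cancel_left] at hα hq hq' ⊢
    by_contra hcon
    exact (hstep j).2.2 α hα k ⟨p, q, hq, hq', not_lt.1 hcon⟩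

end
end
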